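/- Set M = ⟨2⟩ ⊥ U ⊥ U ⊥ U ⊥ U ⊥ U ⊥ E8(−1) ⊥ E8(−1) ⊥ E8(−1) ⊥ E8(−1), an even lattice of rank 43 and signature (6, 37) whose discriminant group A(M) is cyclic of order 2. Every even lattice L of signature (6, 37) for which there exists a group isomorphism A(L) → A(M) preserving the discriminant quadratic forms is isometric to M. -/

import Mathlib

open Matrix

/-- The Gram (Coxeter) matrix of the root lattice `E₈`. -/
def E8M : Matrix (Fin 8) (Fin 8) ℤ :=
  !![2, 0, -1, 0, 0, 0, 0, 0;
     0, 2, 0, -1, 0, 0, 0, 0;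
     -1, 0, 2, -1, 0, 0, 0, 0;
     0, -1, -1, 2, -1, 0, 0, 0;
     0, 0, 0, -1, 2, -1, 0, 0;
     0, 0, 0, 0, -1, 2, -1, 0;
     0, 0, 0, 0, 0, -1, 2, -1;
     0, 0, 0, 0, 0, 0, -1, 2]

/-- The Gram matrix of the hyperbolic plane `U`. -/
def UM : Matrix (Fin 2) (Fin 2) ℤ := !![0, 1; 1, 0]

/-- Gram matrix of the orthogonal direct sum of two lattices given by Gram matrices. -/
def dsum {m k : ℕ} (A : Matrix (Fin m) (Fin m) ℤ) (B : Matrix (Fin k) (Fin k) ℤ) :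
    Matrix (Fin (m + k)) (Fin (m + k)) ℤ :=
  Matrix.reindex finSumFinEquiv finSumFinEquiv (Matrix.fromBlocks A 0 0 B)

/-- The Gram matrix of
`M = ⟨2⟩ ⊥ U ⊥ U ⊥ U ⊥ U ⊥ U ⊥ E₈(−1) ⊥ E₈(−1) ⊥ E₈(−1) ⊥ E₈(−1)`. -/
def M43 : Matrix (Fin 43) (Fin 43) ℤ := dsum (dsum (dsum (dsum (dsum (dsum (dsum (dsum (dsum !![2] UM) UM) UM) UM) UM) (-E8M)) (-E8M)) (-E8M)) (-E8M)

/-- Componentwise coercion `ℤⁿ → ℚⁿ`. -/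
def ratify {n : ℕ} (x : Fin n → ℤ) : Fin n → ℚ := fun i => (x i : ℚ)

/-- The discriminant group `A(L) = L*/L` of the lattice `ℤⁿ` with Gram matrix `G`,
presented as the cokernel `ℤⁿ/G·ℤⁿ` (multiplication by `G` identifies `L*/L` with
this cokernel when `det G ≠ 0`). -/
def DiscGroup {n : ℕ} (G : Matrix (Fin n) (Fin n) ℤ) :=
  (Fin n → ℤ) ⧸ LinearMap.range (Matrix.mulVecLin G)

instance {n : ℕ} (G : Matrix (Fin n) (Fin n) ℤ) : AddCommGroup (DiscGroup G) :=
  inferInstanceAs (AddCommGroup ((Fin n → ℤ) ⧸ LinearMap.range (Matrix.mulVecLin G)))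

instance {n : ℕ} (G : Matrix (Fin n) (Fin n) ℤ) : Module ℤ (DiscGroup G) :=
  inferInstanceAs (Module ℤ ((Fin n → ℤ) ⧸ LinearMap.range (Matrix.mulVecLin G)))

/-- The class of `u ∈ ℤⁿ` in the discriminant group. -/
def discMk {n : ℕ} (G : Matrix (Fin n) (Fin n) ℤ) (u : Fin n → ℤ) : DiscGroup G :=
  Submodule.Quotient.mk u

/-- The discriminant quadratic form `q_L : A(L) → ℚ/2ℤ` in the cokernel presentation. -/
noncomputable def discQuad {n : ℕ} (G : Matrix (Fin n) (Fin n) ℤ) (u : Fin n → ℤ) :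
    AddCircle (2 : ℚ) :=
  ((ratify u ⬝ᵥ ((G.map (Int.cast : ℤ → ℚ))⁻¹).mulVec (ratify u) : ℚ) : AddCircle (2 : ℚ))

/-- `G` has signature `(p, q)`: over `ℝ` the form is congruent to a diagonal form with
`p` entries `+1` and `q` entries `−1`. -/
def HasSignature {n : ℕ} (G : Matrix (Fin n) (Fin n) ℤ) (p q : ℕ) : Prop :=
  ∃ (P : Matrix (Fin n) (Fin n) ℝ) (d : Fin n → ℝ), IsUnit P.det ∧
    (∀ i, d i = 1 ∨ d i = -1) ∧
    (Finset.univ.filter fun i => d i = 1).card = p ∧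
    (Finset.univ.filter fun i => d i = -1).card = q ∧
    P.transpose * (G.map (Int.cast : ℤ → ℝ)) * P = Matrix.diagonal d

section NeutralForms

/-- The diagonal quadratic form with weights `w` has a totally isotropic subspace of at least
half the dimension. -/
def Neutral {K ι : Type*} [Field K] [Fintype ι] (w : ι → K) : Prop :=
  ∃ S : Submodule K (ι → K), (∀ x ∈ S, ∑ i, w i * x i ^ 2 = 0) ∧
    Fintype.card ι ≤ 2 * Module.finrank K S

variable {K ι κ : Type*} [Field K] [Fintype ι] [Fintype κ]

theorem finrank_map_add_finrank_inf_ker {κ : Type*} (p : Submodule K (ι → K))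
    (f : (ι → K) →ₗ[K] (κ → K)) :
    Module.finrank K (p.map f) + Module.finrank K ↥(p ⊓ LinearMap.ker f) = Module.finrank K p := by
  rw [← LinearMap.finrank_range_add_finrank_ker (f.domRestrict p), LinearMap.range_domRestrict,
    LinearMap.ker_domRestrict, ← Submodule.finrank_map_subtype_eq p, Submodule.map_comap_subtype]

theorem Neutral.of_equiv (e : ι ≃ κ) {w : κ → K} {u : ι → K} (h : Neutral u)
    (hw : ∀ i, w (e i) = u i) : Neutral w := by
  obtain ⟨S, hS, hc⟩ := h
  refine ⟨S.map (LinearEquiv.funCongrLeft K K e.symm).toLinearMap, ?_, ?_⟩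
  · rintro _ ⟨x, hx, rfl⟩
    rw [← hS x hx, ← e.sum_comp]
    simp [LinearMap.funLeft_apply, hw]
  · rw [← Fintype.card_congr e]
    exact hc.trans_eq (by rw [LinearEquiv.finrank_map_eq])

/-- The product of two submodules of function spaces as a submodule of functions on the sum. -/
def sumSubmodule (S : Submodule K (ι → K)) (T : Submodule K (κ → K)) :
    Submodule K (ι ⊕ κ → K) :=
  (S.prod T).map (LinearEquiv.sumArrowLequivProdArrow ι κ K K).symm.toLinearMap

theorem mem_sumSubmodule {ι κ : Type*} {S : Submodule K (ι → K)} {T : Submodule K (κ → K)}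
    {x : ι ⊕ κ → K} :
    x ∈ sumSubmodule S T ↔ (fun i => x (.inl i)) ∈ S ∧ (fun j => x (.inr j)) ∈ T := by
  constructor
  · rintro ⟨⟨a, b⟩, ⟨ha, hb⟩, rfl⟩
    exact ⟨ha, hb⟩
  · rintro ⟨ha, hb⟩
    refine ⟨⟨_, _⟩, ⟨ha, hb⟩, ?_⟩
    ext (i | j) <;> rfl

theorem finrank_sumSubmodule (S : Submodule K (ι → K)) (T : Submodule K (κ → K)) :
    Module.finrank K (sumSubmodule S T) = Module.finrank K S + Module.finrank K T := by
  have h : S.prod T = LinearMap.range (S.subtype.prodMap T.subtype) := by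
    rw [LinearMap.range_prodMap, Submodule.range_subtype, Submodule.range_subtype]
  rw [sumSubmodule, LinearEquiv.finrank_map_eq, h, LinearMap.finrank_range_of_inj
    (Function.Injective.prodMap S.injective_subtype T.injective_subtype), Module.finrank_prod]

theorem Neutral.sum {w : ι → K} {u : κ → K} (hw : Neutral w) (hu : Neutral u) :
    Neutral (Sum.elim w u) := by
  obtain ⟨S, hS, hc⟩ := hw
  obtain ⟨T, hT, hd⟩ := hu
  refine ⟨sumSubmodule S T, ?_, ?_⟩
  · intro x hx
    rw [mem_sumSubmodule] at hx
    simp [hS _ hx.1, hT _ hx.2]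
  · rw [finrank_sumSubmodule, Fintype.card_sum]
    omega

/-- The diagonal bilinear form with weights `w`. -/
noncomputable def diagForm [DecidableEq ι] (w : ι → K) : LinearMap.BilinForm K (ι → K) :=
  Matrix.toBilin' (Matrix.diagonal w)

theorem diagForm_apply [DecidableEq ι] (w x y : ι → K) :
    diagForm w x y = ∑ i, w i * x i * y i := by
  rw [diagForm, Matrix.toBilin'_apply']
  simp only [dotProduct, Matrix.mulVec_diagonal]
  exact Finset.sum_congr rfl fun i _ => by ring

theorem diagForm_nondegenerate [DecidableEq ι] {w : ι → K} (hw : ∀ i, w i ≠ 0) :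
    (diagForm w).Nondegenerate := by
  refine LinearMap.BilinForm.nondegenerate_toBilin'_of_det_ne_zero' _ ?_
  rw [Matrix.det_diagonal]
  exact Finset.prod_ne_zero_iff.mpr fun i _ => hw i

theorem sum_mul_mul_eq_zero (h2 : (2 : K) ≠ 0) {w : ι → K} {S : Submodule K (ι → K)}
    (hS : ∀ x ∈ S, ∑ i, w i * x i ^ 2 = 0) {x y : ι → K} (hx : x ∈ S) (hy : y ∈ S) :
    ∑ i, w i * x i * y i = 0 := by
  have h := hS _ (S.add_mem hx hy)
  have e : ∑ i, w i * (x + y) i ^ 2 = ∑ i, w i * x i ^ 2 + ∑ i, w i * y i ^ 2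
      + 2 * ∑ i, w i * x i * y i := by
    rw [Finset.mul_sum, ← Finset.sum_add_distrib, ← Finset.sum_add_distrib]
    exact Finset.sum_congr rfl fun i _ => by simp only [Pi.add_apply]; ring
  rw [e, hS x hx, hS y hy, zero_add, zero_add] at h
  exact (mul_eq_zero.mp h).resolve_left h2

theorem finrank_add_le_of_orthogonal {w : ι → K} (hw : ∀ i, w i ≠ 0)
    {S T : Submodule K (ι → K)} (h : ∀ x ∈ S, ∀ y ∈ T, ∑ i, w i * x i * y i = 0) :
    Module.finrank K S + Module.finrank K T ≤ Fintype.card ι := by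
  classical
  have h1 : T ≤ (diagForm w).orthogonal S := fun y hy x hx => by
    show diagForm w x y = 0
    rw [diagForm_apply]
    exact h x hx y hy
  have h2 := Submodule.finrank_mono h1
  rw [LinearMap.BilinForm.finrank_orthogonal (diagForm_nondegenerate hw),
    Module.finrank_fintype_fun_eq_card] at h2
  have h3 := Submodule.finrank_le S
  rw [Module.finrank_fintype_fun_eq_card] at h3
  omega

theorem two_finrank_le_of_isotropic (h2 : (2 : K) ≠ 0) {w : ι → K} (hw : ∀ i, w i ≠ 0)
    {S : Submodule K (ι → K)} (hS : ∀ x ∈ S, ∑ i, w i * x i ^ 2 = 0) :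
    2 * Module.finrank K S ≤ Fintype.card ι := by
  have := finrank_add_le_of_orthogonal hw (S := S) (T := S)
    fun x hx y hy => sum_mul_mul_eq_zero h2 hS hx hy
  omega

/-- Witt cancellation for neutral forms. -/
theorem Neutral.cancel (h2 : (2 : K) ≠ 0) {w : ι → K} {u : κ → K} (hw : ∀ i, w i ≠ 0)
    (hu : ∀ i, u i ≠ 0) (h : Neutral (Sum.elim w u)) (hN : Neutral u) : Neutral w := by
  obtain ⟨S, hS, hc⟩ := h
  obtain ⟨J, hJ, hd⟩ := hN
  have hwu : ∀ i, Sum.elim w u i ≠ 0 := by rintro (i | i) <;> simp [hw, hu]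
  set A : Submodule K (ι ⊕ κ → K) := sumSubmodule ⊤ J with hA
  set f : (ι ⊕ κ → K) →ₗ[K] (ι → K) := LinearMap.funLeft K K Sum.inl with hf
  set D := S ⊓ A ⊓ LinearMap.ker f with hD
  refine ⟨(S ⊓ A).map f, ?_, ?_⟩
  · rintro _ ⟨x, ⟨hxS, hxA⟩, rfl⟩
    have h1 := hS x hxS
    have h2 := hJ _ (mem_sumSubmodule.mp hxA).2
    rw [Fintype.sum_sum_type] at h1
    simp only [Sum.elim_inl, Sum.elim_inr, h2, add_zero] at h1
    exact h1
  · have k1 := Submodule.finrank_sup_add_finrank_inf_eq S A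
    have k2 : Module.finrank K ↥(S ⊔ A) + Module.finrank K D ≤ Fintype.card (ι ⊕ κ) := by
      apply finrank_add_le_of_orthogonal hwu
      intro x hx y hy
      obtain ⟨s, hs, a, ha, rfl⟩ := Submodule.mem_sup.mp hx
      obtain ⟨⟨hyS, hyA⟩, hyf⟩ := hy
      have e1 := sum_mul_mul_eq_zero h2 hS hs hyS
      have e2 := sum_mul_mul_eq_zero h2 hJ (mem_sumSubmodule.mp ha).2 (mem_sumSubmodule.mp hyA).2
      have e3 : ∀ i, y (.inl i) = 0 := fun i => congrFun (LinearMap.mem_ker.mp hyf) i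
      have e4 : ∑ i, Sum.elim w u i * a i * y i = 0 := by
        rw [Fintype.sum_sum_type]
        simp [e3, e2]
      simp only [Pi.add_apply, mul_add, add_mul, Finset.sum_add_distrib, e1, e4, add_zero]
    have k3 : Module.finrank K A = Fintype.card ι + Module.finrank K J := by
      rw [hA, finrank_sumSubmodule, finrank_top, Module.finrank_fintype_fun_eq_card]
    have k4 := finrank_map_add_finrank_inf_ker (S ⊓ A) f
    rw [← hD] at k4
    rw [Fintype.card_sum] at k2 hc
    omega

theorem Neutral.exists_isotropic {w : ι → K} {u : κ → K} (h : Neutral (Sum.elim w u))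
    (hc : Fintype.card κ < Fintype.card ι) : ∃ x : ι → K, x ≠ 0 ∧ ∑ i, w i * x i ^ 2 = 0 := by
  obtain ⟨S, hS, hd⟩ := h
  set A : Submodule K (ι ⊕ κ → K) := sumSubmodule ⊤ ⊥ with hA
  have k1 := Submodule.finrank_sup_add_finrank_inf_eq S A
  have k2 := Submodule.finrank_le (S ⊔ A)
  have k3 : Module.finrank K A = Fintype.card ι := by
    rw [hA, finrank_sumSubmodule, finrank_top, finrank_bot, Module.finrank_fintype_fun_eq_card,
      add_zero]
  rw [Module.finrank_fintype_fun_eq_card] at k2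
  rw [Fintype.card_sum] at k2 hd
  have k4 : S ⊓ A ≠ ⊥ := by
    intro hb
    rw [hb, finrank_bot] at k1
    omega
  obtain ⟨x, ⟨hxS, hxA⟩, hx0⟩ := (Submodule.ne_bot_iff _).mp k4
  have hx2 : ∀ j, x (.inr j) = 0 := fun j =>
    congrFun ((Submodule.mem_bot K).mp (mem_sumSubmodule.mp hxA).2) j
  refine ⟨fun i => x (.inl i), fun h0 => hx0 ?_, ?_⟩
  · ext (i | j)
    · exact congrFun h0 i
    · exact hx2 j
  · have h1 := hS x hxS
    rw [Fintype.sum_sum_type] at h1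
    simpa [hx2] using h1

theorem neutral_of_congruent [DecidableEq ι] {w u : ι → K} (C : Matrix ι ι K)
    (hC : Cᵀ * Matrix.diagonal w * C = Matrix.diagonal u) :
    Neutral (Sum.elim w (fun i => - u i)) := by
  let g : (ι → K) →ₗ[K] (ι ⊕ ι → K) :=
    (LinearEquiv.sumArrowLequivProdArrow ι ι K K).symm.toLinearMap ∘ₗ
      (C.mulVecLin.prod LinearMap.id)
  have hg : Function.Injective g := by
    intro x y hxy
    ext i
    exact congrFun hxy (.inr i)
  refine ⟨LinearMap.range g, ?_, ?_⟩
  · rintro _ ⟨x, rfl⟩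
    have e : (C *ᵥ x) ⬝ᵥ (Matrix.diagonal w *ᵥ (C *ᵥ x)) = x ⬝ᵥ (Matrix.diagonal u *ᵥ x) := by
      rw [← hC, ← Matrix.mulVec_mulVec, ← Matrix.mulVec_mulVec, Matrix.dotProduct_mulVec x,
        Matrix.vecMul_transpose]
    simp only [dotProduct, Matrix.mulVec_diagonal] at e
    rw [Fintype.sum_sum_type]
    have e1 : ∀ i, g x (.inl i) = (C *ᵥ x) i := fun i => rfl
    have e2 : ∀ i, g x (.inr i) = x i := fun i => rfl
    simp only [Sum.elim_inl, Sum.elim_inr, e1, e2, neg_mul, Finset.sum_neg_distrib]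
    rw [← sub_eq_add_neg, sub_eq_zero]
    convert e using 2 <;> ring
  · rw [LinearMap.finrank_range_of_inj hg, Module.finrank_fintype_fun_eq_card, Fintype.card_sum]
    omega

end NeutralForms

section NeutralInvariants

theorem det_fromBlocks_zero₁₁ {R n : Type*} [CommRing R] [Fintype n] [DecidableEq n]
    (X Z Y : Matrix n n R) :
    (Matrix.fromBlocks 0 X Z Y).det = (-1) ^ Fintype.card n * X.det * Z.det := by
  have h1 : Matrix.fromBlocks (1 : Matrix n n R) (1 : Matrix n n R) (0 : Matrix n n R)
      (1 : Matrix n n R) * Matrix.fromBlocks (1 : Matrix n n R) (0 : Matrix n n R)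
      (-1 : Matrix n n R) (1 : Matrix n n R) * Matrix.fromBlocks (1 : Matrix n n R)
      (1 : Matrix n n R) (0 : Matrix n n R) (1 : Matrix n n R) =
      Matrix.fromBlocks 0 1 (-1) 0 := by
    simp [Matrix.fromBlocks_multiply]
  have h2 : (Matrix.fromBlocks (0 : Matrix n n R) (1 : Matrix n n R) (-1 : Matrix n n R)
      (0 : Matrix n n R)).det = 1 := by
    rw [← h1]
    simp
  have h3 : Matrix.fromBlocks 0 X Z Y * Matrix.fromBlocks (0 : Matrix n n R)
      (1 : Matrix n n R) (-1 : Matrix n n R) (0 : Matrix n n R) =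
      Matrix.fromBlocks (-X) 0 (-Y) Z := by
    simp [Matrix.fromBlocks_multiply]
  have h4 := congrArg Matrix.det h3
  rwa [Matrix.det_mul, h2, mul_one, Matrix.det_fromBlocks_zero₁₂, Matrix.det_neg] at h4

variable {K ι : Type*} [Field K] [Fintype ι]

theorem Neutral.prod_eq (h2 : (2 : K) ≠ 0) {w : ι → K} (hw : ∀ i, w i ≠ 0) (h : Neutral w) :
    ∃ (k : ℕ) (c : K), Fintype.card ι = 2 * k ∧ c ≠ 0 ∧ ∏ i, w i = (-1) ^ k * c ^ 2 := by
  classical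
  obtain ⟨S, hS, hc⟩ := h
  have hd := two_finrank_le_of_isotropic h2 hw hS
  obtain ⟨T, hT⟩ := Submodule.exists_isCompl S
  set k := Module.finrank K S with hk
  have hT' : Module.finrank K T = k := by
    have := Submodule.finrank_add_eq_of_isCompl hT
    rw [Module.finrank_fintype_fun_eq_card] at this
    omega
  have hcard : Fintype.card ι = 2 * k := by omega
  let bS := Module.finBasisOfFinrankEq K S hk.symm
  let bT := Module.finBasisOfFinrankEq K T hT'
  let b : Module.Basis (Fin k ⊕ Fin k) K (ι → K) :=
    (bS.prod bT).map (Submodule.prodEquivOfIsCompl S T hT)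
  let e : ι ≃ Fin k ⊕ Fin k := Fintype.equivOfCardEq (by simp [hcard, two_mul])
  let a := (Pi.basisFun K ι).reindex e
  have hG := LinearMap.BilinForm.toMatrix_mul_basis_toMatrix a b (diagForm w)
  have ha : LinearMap.BilinForm.toMatrix a (diagForm w) = Matrix.diagonal (w ∘ e.symm) := by
    ext i j
    rw [LinearMap.BilinForm.toMatrix_apply, diagForm_apply, Matrix.diagonal_apply]
    simp only [a, Module.Basis.reindex_apply, Pi.basisFun_apply, Function.comp]
    rw [Finset.sum_eq_single (e.symm i)]
    · by_cases hij : i = j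
      · simp [hij]
      · simp [hij]
    · intro x _ hx
      simp [hx]
    · simp
  set N := LinearMap.BilinForm.toMatrix b (diagForm w) with hN
  have hN0 : N.toBlocks₁₁ = 0 := by
    ext i j
    have e1 : b (.inl i) = (bS i : ι → K) := by simp [b]
    have e2 : b (.inl j) = (bS j : ι → K) := by simp [b]
    rw [Matrix.toBlocks₁₁, Matrix.of_apply, hN, LinearMap.BilinForm.toMatrix_apply, diagForm_apply,
      e1, e2]
    exact sum_mul_mul_eq_zero h2 hS (bS i).2 (bS j).2
  have hNs : N.toBlocks₂₁ = N.toBlocks₁₂ᵀ := by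
    ext i j
    rw [Matrix.toBlocks₂₁, Matrix.transpose_apply, Matrix.toBlocks₁₂, Matrix.of_apply,
      Matrix.of_apply, hN, LinearMap.BilinForm.toMatrix_apply, LinearMap.BilinForm.toMatrix_apply,
      diagForm_apply, diagForm_apply]
    exact Finset.sum_congr rfl fun i _ => by ring
  have hdetN : N.det = (-1) ^ k * N.toBlocks₁₂.det ^ 2 := by
    conv_lhs => rw [← Matrix.fromBlocks_toBlocks N]
    rw [hN0, hNs, det_fromBlocks_zero₁₁, Matrix.det_transpose, Fintype.card_fin]
    ring
  have hprod : (Matrix.diagonal (w ∘ e.symm)).det = ∏ i, w i := by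
    rw [Matrix.det_diagonal]
    exact e.symm.prod_comp w
  rw [ha] at hG
  have hdet := congrArg Matrix.det hG
  rw [Matrix.det_mul, Matrix.det_mul, Matrix.det_transpose, hprod, hdetN] at hdet
  set P := a.toMatrix b
  have hP : P.det ≠ 0 := by
    have := congrArg Matrix.det (a.toMatrix_mul_toMatrix_flip b)
    rw [Matrix.det_mul, Matrix.det_one] at this
    exact left_ne_zero_of_mul_eq_one this
  have hw0 : ∏ i, w i ≠ 0 := Finset.prod_ne_zero_iff.mpr fun i _ => hw i
  have hX : N.toBlocks₁₂.det ≠ 0 := by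
    intro h0
    rw [h0] at hdet
    have : P.det * (∏ i, w i) * P.det ≠ 0 := mul_ne_zero (mul_ne_zero hP hw0) hP
    exact this (by rw [hdet]; ring)
  refine ⟨k, N.toBlocks₁₂.det / P.det, hcard, div_ne_zero hX hP, ?_⟩
  field_simp
  linear_combination hdet

theorem Neutral.card_pos_eq_card_neg [LinearOrder K] [IsStrictOrderedRing K] {w : ι → K}
    (hw : ∀ i, w i ≠ 0) (h : Neutral w) :
    (Finset.univ.filter fun i => 0 < w i).card = (Finset.univ.filter fun i => w i < 0).card := by
  classical
  obtain ⟨S, hS, hc⟩ := h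
  have key : ∀ u : ι → K, (∀ x ∈ S, ∑ i, u i * x i ^ 2 = 0) →
      (Finset.univ.filter fun i => 0 < u i).card + Module.finrank K S ≤ Fintype.card ι := by
    intro u hu
    have := QuadraticForm.sigPos_add_finrank_le_of_nonpos
      (Q := QuadraticMap.weightedSumSquares K u) (V := S) ?_
    · rw [QuadraticForm.sigPos_weightedSumSquares, Module.finrank_fintype_fun_eq_card] at this
      rwa [← Set.ncard_coe_finset, Finset.coe_filter_univ]
    · intro x hx
      have e := hu x hx
      simp only [QuadraticMap.weightedSumSquares_apply, smul_eq_mul, ← pow_two]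
      exact e.le
  have h1 := key w hS
  have h2 := key (fun i => - w i) (fun x hx => by simp [hS x hx])
  simp only [Left.neg_pos_iff] at h2
  have h3 : (Finset.univ.filter fun i => 0 < w i).card +
      (Finset.univ.filter fun i => w i < 0).card = Fintype.card ι := by
    rw [← Finset.card_univ, ← Finset.card_filter_add_card_filter_not (s := Finset.univ)
      (fun i => 0 < w i)]
    refine congrArg _ (congrArg _ (Finset.filter_congr fun i _ => ?_))
    have := hw i
    rw [not_lt]
    exact ⟨le_of_lt, fun h => lt_of_le_of_ne h this⟩
  omega

end NeutralInvariants

section WittGroup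

/-- Differences of neutral diagonal forms, inside the free abelian group on rational numbers. -/
noncomputable def wittRelations : AddSubgroup (ℚ →₀ ℤ) where
  carrier := {x | ∃ (ι : Type) (_ : Fintype ι) (κ : Type) (_ : Fintype κ) (w : ι → ℚ) (u : κ → ℚ),
    (∀ i, w i ≠ 0) ∧ (∀ i, u i ≠ 0) ∧ Neutral w ∧ Neutral u ∧
      x = ∑ i, Finsupp.single (w i) 1 - ∑ i, Finsupp.single (u i) 1}
  zero_mem' := by
    have h : Neutral (fun _ : Empty => (0 : ℚ)) := ⟨⊥, by simp, by simp⟩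
    exact ⟨Empty, inferInstance, Empty, inferInstance, _, _, nofun, nofun, h, h, by simp⟩
  add_mem' := by
    rintro _ _ ⟨ι, _, κ, _, w, u, hw, hu, nw, nu, rfl⟩
      ⟨ι', _, κ', _, w', u', hw', hu', nw', nu', rfl⟩
    refine ⟨ι ⊕ ι', inferInstance, κ ⊕ κ', inferInstance, _, _, ?_, ?_, nw.sum nw', nu.sum nu', ?_⟩
    · rintro (i | i) <;> simp [hw, hw']
    · rintro (i | i) <;> simp [hu, hu']
    · simp only [Fintype.sum_sum_type, Sum.elim_inl, Sum.elim_inr]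
      abel
  neg_mem' := by
    rintro _ ⟨ι, _, κ, _, w, u, hw, hu, nw, nu, rfl⟩
    exact ⟨κ, inferInstance, ι, inferInstance, u, w, hu, hw, nu, nw, by abel⟩

/-- The Witt group of `ℚ`, presented by diagonal forms modulo neutral forms. -/
abbrev RatWitt : Type := (ℚ →₀ ℤ) ⧸ wittRelations

/-- The Witt class of the form `⟨a⟩`. -/
noncomputable def wittClass (a : ℚ) : RatWitt :=
  QuotientAddGroup.mk' wittRelations (Finsupp.single a 1)

theorem exists_equiv_of_sum_single_eq {ι κ α : Type*} [Fintype ι] [Fintype κ] {w : ι → α}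
    {u : κ → α} (h : ∑ i, Finsupp.single (w i) (1 : ℤ) = ∑ i, Finsupp.single (u i) 1) :
    ∃ e : ι ≃ κ, ∀ i, u (e i) = w i := by
  classical
  have hc : ∀ a, Fintype.card {i // w i = a} = Fintype.card {i // u i = a} := by
    intro a
    have := DFunLike.congr_fun h a
    simp only [Finsupp.coe_finsetSum, Finset.sum_apply, Finsupp.single_apply,
      Finset.sum_boole] at this
    rw [Fintype.card_subtype, Fintype.card_subtype]
    exact_mod_cast this
  refine ⟨(Equiv.sigmaFiberEquiv w).symm.trans
    ((Equiv.sigmaCongrRight fun a => Fintype.equivOfCardEq (hc a)).trans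
      (Equiv.sigmaFiberEquiv u)), fun i => ?_⟩
  exact (Fintype.equivOfCardEq (hc (w i)) ⟨i, rfl⟩).2

theorem sum_wittClass {ι : Type*} [Fintype ι] (w : ι → ℚ) :
    ∑ i, wittClass (w i) =
      QuotientAddGroup.mk' wittRelations (∑ i, Finsupp.single (w i) 1) := by
  rw [map_sum]
  rfl

theorem sum_wittClass_eq_zero_iff {ι : Type} [Fintype ι] {w : ι → ℚ} (hw : ∀ i, w i ≠ 0) :
    ∑ i, wittClass (w i) = 0 ↔ Neutral w := by
  have hN : Neutral (fun _ : Empty => (0 : ℚ)) := ⟨⊥, by simp, by simp⟩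
  rw [sum_wittClass, QuotientAddGroup.mk'_apply, QuotientAddGroup.eq_zero_iff]
  constructor
  · rintro ⟨ι', _, κ', _, a, b, ha, hb, na, nb, h⟩
    have h' : ∑ i, Finsupp.single (Sum.elim w b i) (1 : ℤ) = ∑ i, Finsupp.single (a i) 1 := by
      rw [Fintype.sum_sum_type]
      simp [h]
    obtain ⟨e, he⟩ := exists_equiv_of_sum_single_eq h'
    exact Neutral.cancel two_ne_zero hw hb (na.of_equiv e.symm fun i => by
      rw [← he, Equiv.apply_symm_apply]) nb
  · intro h
    exact ⟨ι, inferInstance, Empty, inferInstance, w, _, hw, nofun, h, hN, by simp⟩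

theorem wittClass_add_neg_mul_sq {a c : ℚ} (ha : a ≠ 0) (hc : c ≠ 0) :
    wittClass a + wittClass (-(a * c ^ 2)) = 0 := by
  have h : Neutral (Sum.elim (fun _ : Unit => a) fun _ : Unit => -(a * c ^ 2)) := by
    refine neutral_of_congruent (Matrix.diagonal fun _ => c) ?_
    rw [Matrix.diagonal_transpose, Matrix.diagonal_mul_diagonal, Matrix.diagonal_mul_diagonal]
    congr 1
    ext
    ring
  rw [← sum_wittClass_eq_zero_iff] at h
  · simpa using h
  · rintro (i | i) <;> simp [ha, hc]

theorem wittClass_neg {a : ℚ} (ha : a ≠ 0) : wittClass (-a) = -wittClass a := by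
  have := wittClass_add_neg_mul_sq ha one_ne_zero
  rw [one_pow, mul_one] at this
  exact (neg_eq_of_add_eq_zero_right this).symm

theorem wittClass_mul_sq {a c : ℚ} (ha : a ≠ 0) (hc : c ≠ 0) :
    wittClass (a * c ^ 2) = wittClass a := by
  have := wittClass_add_neg_mul_sq ha hc
  rw [wittClass_neg (mul_ne_zero ha (pow_ne_zero 2 hc))] at this
  exact (add_neg_eq_zero.mp this).symm

theorem wittClass_add_wittClass {a b : ℚ} (ha : a ≠ 0) (hb : b ≠ 0) (hab : a + b ≠ 0) :
    wittClass a + wittClass b = wittClass (a + b) + wittClass (a * b * (a + b)) := by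
  have h : Neutral (Sum.elim ![a, b] fun i => -![a + b, a * b * (a + b)] i) := by
    refine neutral_of_congruent !![1, -b; 1, a] ?_
    ext i j
    fin_cases i <;> fin_cases j <;> simp [Matrix.mul_apply, Fin.sum_univ_two, Matrix.diagonal] <;>
      ring
  rw [← sum_wittClass_eq_zero_iff] at h
  · simp only [Fintype.sum_sum_type, Fin.sum_univ_two, Sum.elim_inl, Sum.elim_inr,
      Matrix.cons_val_zero, Matrix.cons_val_one] at h
    rw [wittClass_neg hab, wittClass_neg (mul_ne_zero (mul_ne_zero ha hb) hab)] at h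
    rw [← sub_eq_zero, ← h]
    abel
  · rintro (i | i) <;> fin_cases i <;> simp [ha, hb, hab]
    rwa [← neg_add_rev, neg_eq_zero]

end WittGroup

section SmoothIntegers

/-- A nonzero integer all of whose prime factors are smaller than `N`. -/
def IsSmooth (N : ℕ) (n : ℤ) : Prop := n ≠ 0 ∧ ∀ q : ℕ, q.Prime → (q : ℤ) ∣ n → q < N

theorem IsSmooth.mul {N : ℕ} {m n : ℤ} (hm : IsSmooth N m) (hn : IsSmooth N n) :
    IsSmooth N (m * n) :=
  ⟨mul_ne_zero hm.1 hn.1, fun q hq h => (Int.Prime.dvd_mul' hq h).elim (hm.2 q hq) (hn.2 q hq)⟩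

theorem IsSmooth.of_dvd {N : ℕ} {m n : ℤ} (hn : IsSmooth N n) (h : m ∣ n) : IsSmooth N m :=
  ⟨fun h0 => hn.1 (by simpa [h0] using h), fun q hq h' => hn.2 q hq (h'.trans h)⟩

theorem isSmooth_of_abs_lt {N : ℕ} {n : ℤ} (h0 : n ≠ 0) (h : |n| < N) : IsSmooth N n :=
  ⟨h0, fun q _ hd => by
    have := Int.le_of_dvd (abs_pos.mpr h0) ((dvd_abs _ _).mpr hd)
    omega⟩

theorem IsSmooth.neg {N : ℕ} {n : ℤ} (h : IsSmooth N n) : IsSmooth N (-n) :=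
  h.of_dvd (neg_dvd.mpr dvd_rfl)

theorem IsSmooth.intCast_ne_zero {p : ℕ} [hp : Fact p.Prime] {n : ℤ} (h : IsSmooth p n) :
    (n : ZMod p) ≠ 0 := fun h0 =>
  lt_irrefl p (h.2 p hp.out ((ZMod.intCast_zmod_eq_zero_iff_dvd _ _).mp h0))

theorem isSmooth_val {p : ℕ} [hp : Fact p.Prime] {u : ZMod p} (hu : u ≠ 0) :
    IsSmooth p (u.val : ℤ) := by
  refine isSmooth_of_abs_lt ?_ ?_
  · exact_mod_cast (ZMod.val_ne_zero u).mpr hu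
  · rw [abs_of_nonneg (by positivity)]
    exact_mod_cast ZMod.val_lt u

end SmoothIntegers

section SmoothWitt

/-- The subgroup of the Witt group generated by the classes of `N`-smooth integers. -/
noncomputable def smoothWitt (N : ℕ) : AddSubgroup RatWitt :=
  AddSubgroup.closure {x | ∃ n : ℤ, IsSmooth N n ∧ x = wittClass n}

theorem wittClass_mem_smoothWitt {N : ℕ} {n : ℤ} (h : IsSmooth N n) :
    wittClass n ∈ smoothWitt N :=
  AddSubgroup.subset_closure ⟨n, h, rfl⟩

variable (p : ℕ) [hp : Fact p.Prime]

/-- The Witt group modulo smooth classes. -/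
def TameWitt : Type := RatWitt ⧸ smoothWitt p

noncomputable instance : AddCommGroup (TameWitt p) :=
  inferInstanceAs (AddCommGroup (RatWitt ⧸ smoothWitt p))

/-- The projection from the Witt group to its quotient by smooth classes. -/
noncomputable def toTameWitt : RatWitt →+ TameWitt p := QuotientAddGroup.mk' (smoothWitt p)

theorem toTameWitt_eq_zero_iff (p : ℕ) (x : RatWitt) : toTameWitt p x = 0 ↔ x ∈ smoothWitt p :=
  QuotientAddGroup.eq_zero_iff x

/-- The class of `⟨p n⟩` modulo smooth classes. -/
noncomputable def tameClass (n : ℤ) : TameWitt p :=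
  toTameWitt p (wittClass (p * n))

theorem toTameWitt_wittClass_eq_zero (p : ℕ) {n : ℤ} (h : IsSmooth p n) :
    toTameWitt p (wittClass n) = 0 := by
  rw [toTameWitt_eq_zero_iff]
  exact wittClass_mem_smoothWitt h

theorem natCast_prime_ne_zero (p : ℕ) [hp : Fact p.Prime] : (p : ℚ) ≠ 0 := by
  exact_mod_cast hp.out.ne_zero

variable {p}

theorem tameClass_mul_sq {m n : ℤ} (hm : m ≠ 0) (hn : n ≠ 0) :
    tameClass p (m * n ^ 2) = tameClass p m := by
  have h1 : (m : ℚ) ≠ 0 := by exact_mod_cast hm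
  have h2 : (n : ℚ) ≠ 0 := by exact_mod_cast hn
  unfold tameClass
  rw [← wittClass_mul_sq (mul_ne_zero (natCast_prime_ne_zero p) h1) h2]
  congr 2
  push_cast
  ring

theorem tameClass_mul_eq_of_eq_add {c s k r : ℤ} (hc : IsSmooth p c) (hs : IsSmooth p s)
    (hr : 0 < r) (hrp : r < p) (hk : |k| < p) (h : s = k * p + r) :
    tameClass p (c * s) = tameClass p (c * r) := by
  rcases eq_or_ne k 0 with rfl | hk0
  · rw [h]
    simp
  have hks := isSmooth_of_abs_lt hk0 hk
  have hrs : IsSmooth p r := isSmooth_of_abs_lt hr.ne' (by rwa [abs_of_pos hr])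
  have hc' : (c : ℚ) ≠ 0 := by exact_mod_cast hc.1
  have hs' : (s : ℚ) ≠ 0 := by exact_mod_cast hs.1
  have hk' : (k : ℚ) ≠ 0 := by exact_mod_cast hk0
  have hr' : (r : ℚ) ≠ 0 := by exact_mod_cast hr.ne'
  have hp' := natCast_prime_ne_zero p
  have hsum : (p * (c * r * k ^ 2) : ℚ) + c * r ^ 2 * k = c * r * k * s := by
    rw [h]
    push_cast
    ring
  have key := wittClass_add_wittClass (a := p * (c * r * k ^ 2)) (b := c * r ^ 2 * k)
    (by positivity) (by positivity) (by rw [hsum]; positivity)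
  rw [hsum] at key
  have key' := congrArg (toTameWitt p) key
  have z1 := toTameWitt_wittClass_eq_zero p (((hc.mul hrs).mul hrs).mul hks)
  have z2 := toTameWitt_wittClass_eq_zero p (((hc.mul hrs).mul hks).mul hs)
  rw [show ((c * r * r * k : ℤ) : ℚ) = c * r ^ 2 * k by push_cast; ring] at z1
  push_cast at z2
  rw [map_add, map_add, z2, z1, add_zero, zero_add] at key'
  calc tameClass p (c * s) = tameClass p (c * s * (c * r ^ 2 * k ^ 2) ^ 2) :=
        (tameClass_mul_sq (hc.mul hs).1
          (mul_ne_zero (mul_ne_zero hc.1 (pow_ne_zero _ hrs.1)) (pow_ne_zero _ hks.1))).symm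
    _ = tameClass p (c * r * k ^ 2) := by
        unfold tameClass
        push_cast
        rw [key']
        congr 2
        ring
    _ = tameClass p (c * r) := tameClass_mul_sq (hc.mul hrs).1 hks.1

theorem IsSmooth.emod_pos {s : ℤ} (hs : IsSmooth p s) : 0 < s % p := by
  have hp0 : (p : ℤ) ≠ 0 := by exact_mod_cast hp.out.ne_zero
  refine lt_of_le_of_ne (Int.emod_nonneg _ hp0) fun h => ?_
  exact lt_irrefl p (hs.2 p hp.out (Int.dvd_of_emod_eq_zero h.symm))

theorem tameClass_mul_natCast_emod (s : ℕ) : ∀ c : ℤ, IsSmooth p c → IsSmooth p s →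
    tameClass p (c * s) = tameClass p (c * (s % p)) := by
  have hp0 : (0 : ℤ) < p := by exact_mod_cast hp.out.pos
  induction s using induction_on_primes with
  | zero => exact fun c _ h => absurd rfl h.1
  | one =>
    intro c _ _
    have : ((1 : ℕ) : ℤ) % p = 1 := Int.emod_eq_of_lt zero_le_one (by exact_mod_cast hp.out.one_lt)
    rw [this]
    simp
  | prime_mul q a hq ih =>
    intro c hc hqa
    push_cast at hqa ⊢
    have hqs : IsSmooth p q := hqa.of_dvd (dvd_mul_right _ _)
    have has : IsSmooth p a := hqa.of_dvd (dvd_mul_left _ _)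
    have hqp : (q : ℤ) < p := by exact_mod_cast hqs.2 q hq dvd_rfl
    have hq0 : (0 : ℤ) < q := by exact_mod_cast hq.pos
    have ha0 := has.emod_pos
    have hap : (a : ℤ) % p < p := Int.emod_lt_of_pos _ hp0
    have hr : IsSmooth p ((a : ℤ) % p) := isSmooth_of_abs_lt ha0.ne' (by rwa [abs_of_pos ha0])
    rw [← mul_assoc, ih (c * q) (hc.mul hqs) has, mul_assoc, Int.mul_emod,
      Int.emod_eq_of_lt hq0.le hqp]
    have hs := hqs.mul hr
    refine tameClass_mul_eq_of_eq_add (k := q * (a % p) / p) hc hs hs.emod_pos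
      (Int.emod_lt_of_pos _ hp0) ?_ ?_
    · rw [abs_of_nonneg (Int.ediv_nonneg (by positivity) hp0.le)]
      refine Int.ediv_lt_of_lt_mul hp0 ?_
      nlinarith
    · rw [mul_comm _ (p : ℤ), Int.mul_ediv_add_emod]

theorem tameClass_eq_val {s : ℤ} (hs : IsSmooth p s) :
    tameClass p s = tameClass p (s : ZMod p).val := by
  have hp0 : (0 : ℤ) < p := by exact_mod_cast hp.out.pos
  have h1 : IsSmooth p 1 := ⟨one_ne_zero, fun q hq h => by
    have := Int.le_of_dvd one_pos h
    have := hq.two_le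
    omega⟩
  rw [ZMod.val_intCast]
  obtain ⟨n, rfl | rfl⟩ := s.eq_nat_or_neg
  · simpa using tameClass_mul_natCast_emod n 1 h1 hs
  · have hn : IsSmooth p n := by simpa using hs.neg
    have hr0 := hn.emod_pos
    have hrp : (n : ℤ) % p < p := Int.emod_lt_of_pos _ hp0
    have hr : IsSmooth p ((n : ℤ) % p) := isSmooth_of_abs_lt hr0.ne' (by rwa [abs_of_pos hr0])
    have e1 := tameClass_mul_natCast_emod n (-1) h1.neg hn
    rw [neg_one_mul, neg_one_mul] at e1
    rw [e1]
    have e2 : -(n : ℤ) % p = p - n % p := by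
      have h2 : -(n : ℤ) % p = (p - n % p) % p := by
        have := Int.emod_add_mul_ediv (n : ℤ) p
        exact Int.modEq_iff_dvd.mpr ⟨n / p + 1, by linarith⟩
      rw [h2, Int.emod_eq_of_lt (by omega) (by omega)]
    have e3 := tameClass_mul_eq_of_eq_add (k := -1) (r := p - n % p) h1 hr.neg (by omega) (by omega)
      (by simpa using hp.out.one_lt) (by ring)
    rw [e2]
    simpa using e3

/-- The class of `⟨p s⟩`, for `s` any smooth lift of `u`, modulo smooth classes. -/
noncomputable def residueClass (p : ℕ) [Fact p.Prime] (u : ZMod p) : TameWitt p :=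
  tameClass p u.val

theorem tameClass_eq_residueClass {s : ℤ} (hs : IsSmooth p s) :
    tameClass p s = residueClass p s := tameClass_eq_val hs

theorem residueClass_mul_sq {u v : ZMod p} (hu : u ≠ 0) (hv : v ≠ 0) :
    residueClass p (u * v ^ 2) = residueClass p u := by
  have h := tameClass_mul_sq (p := p) (isSmooth_val hu).1 (isSmooth_val hv).1
  rw [tameClass_eq_residueClass ((isSmooth_val hu).mul
    (by rw [pow_two]; exact (isSmooth_val hv).mul (isSmooth_val hv)))] at h
  simp only [Int.cast_mul, Int.cast_pow, Int.cast_natCast, ZMod.natCast_zmod_val] at h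
  exact h

theorem residueClass_neg {u : ZMod p} (hu : u ≠ 0) :
    residueClass p (-u) = - residueClass p u := by
  have h := tameClass_eq_residueClass (isSmooth_val hu).neg
  simp only [Int.cast_neg, Int.cast_natCast, ZMod.natCast_zmod_val] at h
  have hu' : ((u.val : ℤ) : ℚ) ≠ 0 := by exact_mod_cast (isSmooth_val hu).1
  rw [← h, tameClass, residueClass, tameClass, Int.cast_neg, mul_neg,
    wittClass_neg (mul_ne_zero (natCast_prime_ne_zero p) hu'), map_neg]

theorem residueClass_add {u v : ZMod p} (hu : u ≠ 0) (hv : v ≠ 0) (huv : u + v ≠ 0) :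
    residueClass p u + residueClass p v =
      residueClass p (u + v) + residueClass p (u * v * (u + v)) := by
  obtain ⟨s, t, hs, ht, hst, rfl, rfl⟩ : ∃ s t : ℤ, IsSmooth p s ∧ IsSmooth p t ∧
      IsSmooth p (s + t) ∧ (s : ZMod p) = u ∧ (t : ZMod p) = v := by
    have h1 := ZMod.val_lt u
    have h2 := ZMod.val_lt v
    have h3 : (((u.val : ℤ) + v.val : ℤ) : ZMod p) = u + v := by simp
    by_cases h : u.val + v.val < p
    · refine ⟨u.val, v.val, isSmooth_val hu, isSmooth_val hv, isSmooth_of_abs_lt ?_ ?_,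
        by simp, by simp⟩
      · intro h0
        rw [h0] at h3
        exact huv (by simpa using h3.symm)
      · rw [abs_of_nonneg (by positivity)]
        exact_mod_cast h
    · refine ⟨u.val, v.val - p, isSmooth_val hu, isSmooth_of_abs_lt (by omega) ?_,
        isSmooth_of_abs_lt ?_ ?_, by simp, by simp⟩
      · have := (ZMod.val_ne_zero v).mpr hv
        rw [abs_lt]
        omega
      · intro h0
        refine huv ?_
        rw [← h3, show (u.val : ℤ) + v.val = p by omega]
        simp
      · rw [abs_lt]
        omega
  have hp' := natCast_prime_ne_zero p
  have hs' : (s : ℚ) ≠ 0 := by exact_mod_cast hs.1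
  have ht' : (t : ℚ) ≠ 0 := by exact_mod_cast ht.1
  have hst' : (s + t : ℚ) ≠ 0 := by exact_mod_cast hst.1
  have key := wittClass_add_wittClass (a := p * s) (b := p * t) (by positivity) (by positivity)
    (by rw [← mul_add]; positivity)
  have key' := congrArg (toTameWitt p) key
  rw [map_add, map_add, show (p * s * (p * t) * (p * s + p * t) : ℚ) =
    p * (s * t * (s + t)) * p ^ 2 by ring, wittClass_mul_sq (by positivity) hp', ← mul_add] at key'
  have e1 := tameClass_eq_residueClass hst
  have e2 := tameClass_eq_residueClass ((hs.mul ht).mul hst)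
  push_cast at e1 e2
  rw [← tameClass_eq_residueClass hs, ← tameClass_eq_residueClass ht, ← e1, ← e2]
  unfold tameClass
  push_cast
  exact key'

end SmoothWitt

section ResidueRelations

variable {p : ℕ} [hp : Fact p.Prime]

theorem residueClass_of_isSquare {u : ZMod p} (hu : u ≠ 0) (h : IsSquare u) :
    residueClass p u = residueClass p 1 := by
  obtain ⟨v, rfl⟩ := h
  rw [← pow_two, ← residueClass_mul_sq one_ne_zero (right_ne_zero_of_mul hu), one_mul]

theorem residueClass_of_not_isSquare {u v : ZMod p} (hu : ¬ IsSquare u) (hv : ¬ IsSquare v) :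
    residueClass p u = residueClass p v := by
  have hu0 : u ≠ 0 := fun h => hu (h ▸ IsSquare.zero)
  have hv0 : v ≠ 0 := fun h => hv (h ▸ IsSquare.zero)
  have h : quadraticChar (ZMod p) (u * v) = 1 := by
    rw [map_mul, quadraticChar_neg_one_iff_not_isSquare.mpr hu,
      quadraticChar_neg_one_iff_not_isSquare.mpr hv]
    rfl
  obtain ⟨c, hc⟩ := (quadraticChar_one_iff_isSquare (mul_ne_zero hu0 hv0)).mp h
  have hc0 : c ≠ 0 := by
    rintro rfl
    exact mul_ne_zero hu0 hv0 (by simpa using hc)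
  rw [← residueClass_mul_sq hu0 hv0, ← residueClass_mul_sq hv0 hc0]
  congr 1
  linear_combination v * hc

theorem residueClass_one_add_one {v : ZMod p} (hv : ¬ IsSquare v) :
    residueClass p 1 + residueClass p 1 = residueClass p v + residueClass p v := by
  obtain ⟨a, b, h⟩ := ZMod.sq_add_sq p v
  have ha : a ≠ 0 := by
    rintro rfl
    exact hv ⟨b, by rw [← h]; ring⟩
  have hb : b ≠ 0 := by
    rintro rfl
    exact hv ⟨a, by rw [← h]; ring⟩
  have hv0 : v ≠ 0 := fun h => hv (h ▸ IsSquare.zero)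
  have := residueClass_add (pow_ne_zero 2 ha) (pow_ne_zero 2 hb) (by rwa [h])
  rw [h, show a ^ 2 * b ^ 2 * v = v * (a * b) ^ 2 by ring,
    residueClass_mul_sq hv0 (mul_ne_zero ha hb), residueClass_of_isSquare (pow_ne_zero 2 ha)
    ⟨a, pow_two a⟩, residueClass_of_isSquare (pow_ne_zero 2 hb) ⟨b, pow_two b⟩] at this
  exact this

theorem sum_residueClass_eq_zero (hp2 : p ≠ 2) {ι : Type*} [Fintype ι] {b : ι → ZMod p}
    (hb : ∀ i, b i ≠ 0) {k : ℕ} {c : ZMod p} (hk : Fintype.card ι = 2 * k) (hc : c ≠ 0)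
    (h : ∏ i, b i = (-1) ^ k * c ^ 2) : ∑ i, residueClass p (b i) = 0 := by
  classical
  have hF : ringChar (ZMod p) ≠ 2 := by rwa [ZMod.ringChar_zmod_n]
  obtain ⟨v, hv⟩ := FiniteField.exists_nonsquare hF
  set α := residueClass p 1 with hα
  set β := residueClass p v with hβ
  have hαβ : α + α = β + β := residueClass_one_add_one hv
  set J := Finset.univ.filter fun i => ¬ IsSquare (b i) with hJ
  have hsum : ∑ i, residueClass p (b i) = (Fintype.card ι : ℤ) • α + (J.card : ℤ) • (β - α) := by
    have h1 : ∀ i, residueClass p (b i) = α + if ¬ IsSquare (b i) then β - α else 0 := by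
      intro i
      split_ifs with hi
      · rw [residueClass_of_isSquare (hb i) hi, add_zero]
      · rw [residueClass_of_not_isSquare hi hv]
        abel
    simp only [h1, Finset.sum_add_distrib, ← Finset.sum_filter, Finset.sum_const, natCast_zsmul,
      Finset.card_univ, hJ]
  have hchar : (-1 : ℤ) ^ J.card = quadraticChar (ZMod p) (-1) ^ k := by
    have e := congrArg (quadraticChar (ZMod p)) h
    rw [map_prod, map_mul, map_pow, map_pow, quadraticChar_sq_one hc, mul_one] at e
    rw [← e, hJ, Finset.card_filter, ← Finset.prod_pow_eq_pow_sum]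
    refine Finset.prod_congr rfl fun i _ => ?_
    split_ifs with hi
    · rw [pow_zero, (quadraticChar_one_iff_isSquare (hb i)).mpr hi]
    · rw [pow_one, quadraticChar_neg_one_iff_not_isSquare.mpr hi]
  have hneg1 : (-1 : ZMod p) ≠ 0 := neg_ne_zero.mpr one_ne_zero
  have hneg : residueClass p (-1) = -α := residueClass_neg one_ne_zero
  rw [hsum, hk]
  by_cases hs : IsSquare (-1 : ZMod p)
  · rw [(quadraticChar_one_iff_isSquare hneg1).mpr hs, one_pow] at hchar
    obtain ⟨j, hj⟩ := (neg_one_pow_eq_one_iff_even (by norm_num)).mp hchar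
    rw [residueClass_of_isSquare hneg1 hs] at hneg
    have h2 : α + α = 0 := by
      nth_rewrite 1 [hα]
      rw [hneg]
      abel
    have h2' : β + β = 0 := hαβ ▸ h2
    rw [hj]
    push_cast
    calc ((2 * k : ℤ) • α + ((j + j : ℤ)) • (β - α)) =
        (k : ℤ) • (α + α) + (j : ℤ) • ((β + β) - (α + α)) := by module
      _ = 0 := by simp [h2, h2']
  · rw [quadraticChar_neg_one_iff_not_isSquare.mpr hs] at hchar
    have hβα : β = -α := by rw [← hneg, hβ, residueClass_of_not_isSquare hv hs]
    have h4 : (4 : ℤ) • α = 0 := by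
      calc (4 : ℤ) • α = (α + α) - (-α + -α) := by module
        _ = 0 := by rw [← hβα, hαβ, sub_self]
    obtain ⟨j, hj⟩ : ∃ j : ℤ, (k : ℤ) - J.card = 2 * j := by
      rcases Nat.even_or_odd J.card with h1 | h1 <;> rcases Nat.even_or_odd k with h2 | h2 <;>
        simp only [h1.neg_one_pow, h2.neg_one_pow] at hchar
      · obtain ⟨a, ha⟩ := h1
        obtain ⟨b, hb⟩ := h2
        exact ⟨b - a, by omega⟩
      · omega
      · omega
      · obtain ⟨a, ha⟩ := h1
        obtain ⟨b, hb⟩ := h2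
        exact ⟨b - a, by omega⟩
    calc (((2 * k : ℕ) : ℤ) • α + (J.card : ℤ) • (β - α)) = (2 * ((k : ℤ) - J.card)) • α := by
          rw [hβα]
          push_cast
          module
      _ = j • (4 : ℤ) • α := by
          rw [hj]
          module
      _ = 0 := by rw [h4, smul_zero]

end ResidueRelations

section Residue

variable {p : ℕ} [hp : Fact p.Prime]

/-- Reduction modulo `p` of a rational subspace does not lower its dimension. -/
theorem exists_reduction {κ : Type*} [Fintype κ] (S : Submodule ℚ (κ → ℚ)) :
    ∃ T : Submodule (ZMod p) (κ → ZMod p), Module.finrank ℚ S ≤ Module.finrank (ZMod p) T ∧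
      ∀ y ∈ T, ∃ x : κ → ℤ, (fun i => (x i : ℚ)) ∈ S ∧ ∀ i, (x i : ZMod p) = y i := by
  classical
  let f : (κ → ℤ) →ₗ[ℤ] (κ → ℚ) :=
    { toFun := fun x i => (x i : ℚ)
      map_add' := fun x y => by ext; simp
      map_smul' := fun c x => by ext; simp }
  let S₀ : Submodule ℤ (κ → ℤ) := (S.restrictScalars ℤ).comap f
  have hS₀ : ∀ x, x ∈ S₀ ↔ (fun i => (x i : ℚ)) ∈ S := fun x => Iff.rfl
  let b := Module.finBasis ℤ S₀
  let r : Fin (Module.finrank ℤ S₀) → κ → ZMod p := fun j i => ((b j : κ → ℤ) i : ZMod p)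
  have hcast : ∀ (g : Fin (Module.finrank ℤ S₀) → ZMod p) (i : κ),
      ((((∑ j, ((g j).val : ℤ) • (b j) : S₀) : κ → ℤ) i : ℤ) : ZMod p) = (∑ j, g j • r j) i := by
    intro g i
    simp [r, Finset.sum_apply, -ZMod.natCast_val, ZMod.natCast_zmod_val]
  have hr : LinearIndependent (ZMod p) r := by
    rw [Fintype.linearIndependent_iff]
    intro g hg j
    have hdvd : ∀ i, ∃ t : ℤ, ((∑ j, ((g j).val : ℤ) • (b j) : S₀) : κ → ℤ) i = p * t := by
      intro i
      refine (ZMod.intCast_zmod_eq_zero_iff_dvd _ p).mp ?_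
      rw [hcast, hg, Pi.zero_apply]
    choose t ht using hdvd
    have htS : t ∈ S₀ := by
      rw [hS₀]
      have h1 := (∑ j, ((g j).val : ℤ) • (b j) : S₀).2
      rw [hS₀] at h1
      have h2 := S.smul_mem (p : ℚ)⁻¹ h1
      convert h2 using 1
      ext i
      rw [Pi.smul_apply, ht i]
      have := natCast_prime_ne_zero p
      push_cast
      rw [smul_eq_mul, inv_mul_cancel_left₀ this]
    have h3 : (∑ j, ((g j).val : ℤ) • (b j) : S₀) = (p : ℤ) • ⟨t, htS⟩ := by
      ext i
      rw [ht i]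
      simp
    have h4 := congrArg (fun z => b.repr z j) h3
    simp only [map_sum, map_smul, Module.Basis.repr_self, Finsupp.coe_finsetSum, Finset.sum_apply,
      Finsupp.smul_apply, Finsupp.single_apply, smul_eq_mul, mul_ite, mul_one, mul_zero,
      Finset.sum_ite_eq', Finset.mem_univ, if_true] at h4
    have h5 := congrArg (Int.cast : ℤ → ZMod p) h4
    simpa using h5
  refine ⟨Submodule.span (ZMod p) (Set.range r), ?_, ?_⟩
  · rw [finrank_span_eq_card hr, Fintype.card_fin]
    let c := Module.finBasis ℚ S
    have hscale : ∀ j, ∃ (d : ℤ) (x : κ → ℤ), d ≠ 0 ∧ ∀ i, (x i : ℚ) = d * (c j : κ → ℚ) i := by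
      intro j
      obtain ⟨d, hd⟩ := IsLocalization.exist_integer_multiples_of_finite (nonZeroDivisors ℤ)
        (fun i => (c j : κ → ℚ) i)
      choose x hx using hd
      refine ⟨d, x, nonZeroDivisors.coe_ne_zero d, fun i => ?_⟩
      rw [← zsmul_eq_mul]
      exact hx i
    choose d x hd hx using hscale
    have hxS : ∀ j, x j ∈ S₀ := by
      intro j
      rw [hS₀]
      have := S.smul_mem (d j : ℚ) (c j).2
      convert this using 1
      ext i
      rw [hx j i]
      rfl
    have hli : LinearIndependent ℤ fun j => (⟨x j, hxS j⟩ : S₀) := by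
      rw [Fintype.linearIndependent_iff]
      intro g hg j
      have h1 : ∑ j, ((g j : ℚ) * d j) • c j = 0 := by
        ext i
        have := congrArg (fun z : S₀ => (((z : κ → ℤ) i : ℤ) : ℚ)) hg
        simp only [Submodule.coe_sum, Submodule.coe_smul, Finset.sum_apply, Pi.smul_apply,
          smul_eq_mul, Int.cast_sum, Int.cast_mul, hx, ZeroMemClass.coe_zero, Pi.zero_apply,
          Int.cast_zero] at this ⊢
        rw [← this]
        exact Finset.sum_congr rfl fun j _ => by ring
      have h2 := Fintype.linearIndependent_iff.mp c.linearIndependent _ h1 j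
      have h3 : (d j : ℚ) ≠ 0 := by exact_mod_cast hd j
      exact_mod_cast (mul_eq_zero.mp h2).resolve_right h3
    simpa using hli.fintype_card_le_finrank
  · intro y hy
    obtain ⟨g, rfl⟩ := (Submodule.mem_span_range_iff_exists_fun _).mp hy
    refine ⟨(∑ j, ((g j).val : ℤ) • (b j) : S₀), ?_, fun i => ?_⟩
    · exact (hS₀ _).mp (∑ j, ((g j).val : ℤ) • (b j) : S₀).2
    · exact hcast g i

theorem Neutral.residue (hp2 : p ≠ 2) {A B : Type*} [Fintype A] [Fintype B] {a : A → ℤ}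
    {b : B → ℤ} (ha : ∀ i, ¬ (p : ℤ) ∣ a i)
    (h : Neutral (Sum.elim (fun i => (a i : ℚ)) fun i => p * b i)) :
    Neutral fun i => (b i : ZMod p) := by
  obtain ⟨S, hS, hc⟩ := h
  obtain ⟨T, hT, hlift⟩ := exists_reduction (p := p) S
  have h2 : (2 : ZMod p) ≠ 0 := by
    intro h0
    have : ((2 : ℕ) : ZMod p) = 0 := by exact_mod_cast h0
    rw [ZMod.natCast_eq_zero_iff, Nat.prime_dvd_prime_iff_eq hp.out Nat.prime_two] at this
    exact hp2 this
  let πA : (A ⊕ B → ZMod p) →ₗ[ZMod p] (A → ZMod p) := LinearMap.funLeft _ _ Sum.inl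
  let πB : (A ⊕ B → ZMod p) →ₗ[ZMod p] (B → ZMod p) := LinearMap.funLeft _ _ Sum.inr
  have hzero : ∀ x : A ⊕ B → ℤ, (fun i => (x i : ℚ)) ∈ S →
      ∑ i, a i * x (.inl i) ^ 2 + p * ∑ i, b i * x (.inr i) ^ 2 = 0 := by
    intro x hx
    have := hS _ hx
    rw [Fintype.sum_sum_type] at this
    simp only [Sum.elim_inl, Sum.elim_inr] at this
    rw [Finset.mul_sum]
    simp only [← mul_assoc]
    exact_mod_cast this
  have hA : 2 * Module.finrank (ZMod p) (T.map πA) ≤ Fintype.card A := by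
    refine two_finrank_le_of_isotropic h2 (w := fun i => (a i : ZMod p)) (fun i h0 => ha i
      ((ZMod.intCast_zmod_eq_zero_iff_dvd _ p).mp h0)) ?_
    rintro _ ⟨y, hy, rfl⟩
    obtain ⟨x, hx, hxy⟩ := hlift y hy
    have := congrArg (Int.cast : ℤ → ZMod p) (hzero x hx)
    push_cast at this
    simpa [hxy, πA, LinearMap.funLeft_apply] using this
  have e1 := finrank_map_add_finrank_inf_ker T πA
  have e2 := finrank_map_add_finrank_inf_ker (T ⊓ LinearMap.ker πA) πB
  have e3 : T ⊓ LinearMap.ker πA ⊓ LinearMap.ker πB = ⊥ := by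
    rw [eq_bot_iff]
    rintro y ⟨⟨-, h1⟩, h2⟩
    ext (i | i)
    · exact congrFun h1 i
    · exact congrFun h2 i
  rw [e3, finrank_bot, add_zero] at e2
  refine ⟨(T ⊓ LinearMap.ker πA).map πB, ?_, ?_⟩
  · rintro _ ⟨y, ⟨hy, hyA⟩, rfl⟩
    obtain ⟨x, hx, hxy⟩ := hlift y hy
    have hdvd : ∀ i, ∃ t, x (.inl i) = p * t := fun i =>
      (ZMod.intCast_zmod_eq_zero_iff_dvd _ p).mp ((hxy _).trans (congrFun hyA i))
    choose t ht using hdvd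
    have h1 := hzero x hx
    simp only [ht] at h1
    have h3 : (p : ℤ) * (p * ∑ i, a i * t i ^ 2 + ∑ i, b i * x (.inr i) ^ 2) = 0 := by
      rw [← h1, mul_add, Finset.mul_sum, Finset.mul_sum]
      congr 1
      exact Finset.sum_congr rfl fun i _ => by ring
    have h4 := (mul_eq_zero.mp h3).resolve_left (by exact_mod_cast hp.out.ne_zero)
    have := congrArg (Int.cast : ℤ → ZMod p) h4
    push_cast at this
    simpa [hxy, πB, LinearMap.funLeft_apply] using this
  · rw [Fintype.card_sum] at hc
    omega

end Residue

section Descent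

variable {p : ℕ} [hp : Fact p.Prime]

theorem exists_eq_pow_mul_isSmooth {n : ℤ} (hn : IsSmooth (p + 1) n) :
    ∃ (k : ℕ) (m : ℤ), n = p ^ k * m ∧ IsSmooth p m := by
  have hfin : FiniteMultiplicity (p : ℤ) n :=
    Int.finiteMultiplicity_iff.mpr ⟨by simpa using hp.out.ne_one, hn.1⟩
  obtain ⟨m, hm, hpm⟩ := hfin.exists_eq_pow_mul_and_not_dvd
  refine ⟨_, m, hm, fun h0 => hpm (h0 ▸ dvd_zero _), fun q hq hqm => ?_⟩
  have h1 := hn.2 q hq (hm ▸ hqm.mul_left _)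
  refine lt_of_le_of_ne (Nat.lt_succ_iff.mp h1) ?_
  rintro rfl
  exact hpm hqm

theorem exists_wittClass_of_pow_mul {k : ℕ} {m : ℤ} (hm : m ≠ 0) :
    wittClass ((p ^ k * m : ℤ) : ℚ) = wittClass m ∨
      wittClass ((p ^ k * m : ℤ) : ℚ) = wittClass (p * m) := by
  have hp' := natCast_prime_ne_zero p
  have hm' : (m : ℚ) ≠ 0 := by exact_mod_cast hm
  obtain ⟨j, rfl | rfl⟩ := k.even_or_odd'
  · left
    rw [← wittClass_mul_sq hm' (pow_ne_zero j hp')]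
    congr 1
    push_cast
    ring
  · right
    rw [← wittClass_mul_sq (mul_ne_zero hp' hm') (pow_ne_zero j hp')]
    congr 1
    push_cast
    ring

theorem exists_sum_of_mem_smoothWitt {c : RatWitt} (hc : c ∈ smoothWitt (p + 1)) :
    ∃ (A : Type) (_ : Fintype A) (B : Type) (_ : Fintype B) (a : A → ℤ) (b : B → ℤ),
      (∀ i, IsSmooth p (a i)) ∧ (∀ i, IsSmooth p (b i)) ∧
      c = ∑ i, wittClass (a i) + ∑ i, wittClass (p * b i) := by
  induction hc using AddSubgroup.closure_induction with
  | mem x hx =>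
    obtain ⟨n, hn, rfl⟩ := hx
    obtain ⟨k, m, rfl, hm⟩ := exists_eq_pow_mul_isSmooth hn
    rcases exists_wittClass_of_pow_mul (p := p) (k := k) hm.1 with h | h
    · exact ⟨Unit, inferInstance, Empty, inferInstance, fun _ => m, nofun, fun _ => hm, nofun,
        by simpa using h⟩
    · exact ⟨Empty, inferInstance, Unit, inferInstance, nofun, fun _ => m, nofun, fun _ => hm,
        by simpa using h⟩
  | zero => exact ⟨Empty, inferInstance, Empty, inferInstance, nofun, nofun, nofun, nofun, by simp⟩
  | add x y _ _ hx hy =>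
    obtain ⟨A, _, B, _, a, b, ha, hb, rfl⟩ := hx
    obtain ⟨A', _, B', _, a', b', ha', hb', rfl⟩ := hy
    refine ⟨A ⊕ A', inferInstance, B ⊕ B', inferInstance, Sum.elim a a', Sum.elim b b', ?_, ?_, ?_⟩
    · rintro (i | i) <;> simp [ha, ha']
    · rintro (i | i) <;> simp [hb, hb']
    · simp only [Fintype.sum_sum_type, Sum.elim_inl, Sum.elim_inr]
      abel
  | neg x _ hx =>
    obtain ⟨A, _, B, _, a, b, ha, hb, rfl⟩ := hx
    refine ⟨A, inferInstance, B, inferInstance, fun i => - a i, fun i => - b i,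
      fun i => (ha i).neg, fun i => (hb i).neg, ?_⟩
    rw [neg_add, ← Finset.sum_neg_distrib, ← Finset.sum_neg_distrib]
    congr 1
    · refine Finset.sum_congr rfl fun i _ => ?_
      rw [Int.cast_neg, wittClass_neg (by exact_mod_cast (ha i).1)]
    · refine Finset.sum_congr rfl fun i _ => ?_
      have : (b i : ℚ) ≠ 0 := by exact_mod_cast (hb i).1
      rw [Int.cast_neg, mul_neg, wittClass_neg (mul_ne_zero (natCast_prime_ne_zero p) this)]

/-- A class that is a sum of classes of integers prime to `p`. -/
def IsUnramified (p : ℕ) (c : RatWitt) : Prop :=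
  ∃ (ι : Type) (_ : Fintype ι) (u : ι → ℤ), (∀ i, ¬ (p : ℤ) ∣ u i) ∧ c = ∑ i, wittClass (u i)

theorem mem_smoothWitt_of_isUnramified (hp2 : p ≠ 2) {c : RatWitt} (hc : c ∈ smoothWitt (p + 1))
    (hu : IsUnramified p c) : c ∈ smoothWitt p := by
  obtain ⟨A, _, B, _, a, b, ha, hb, rfl⟩ := exists_sum_of_mem_smoothWitt hc
  obtain ⟨ι, _, u, hu, hcu⟩ := hu
  have hu0 : ∀ i, u i ≠ 0 := fun i h => hu i (h ▸ dvd_zero _)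
  have hpd : ∀ {n : ℤ}, IsSmooth p n → ¬ (p : ℤ) ∣ n := fun hn h => lt_irrefl p (hn.2 p hp.out h)
  have hN : Neutral (Sum.elim (fun i => ((Sum.elim a (fun i => - u i) i : ℤ) : ℚ))
      fun i => (p * b i : ℚ)) := by
    rw [← sum_wittClass_eq_zero_iff]
    · have h2 : ∀ i, wittClass (-(u i : ℚ)) = - wittClass (u i) := fun i =>
        wittClass_neg (by exact_mod_cast hu0 i)
      simp only [Fintype.sum_sum_type, Sum.elim_inl, Sum.elim_inr, Int.cast_neg, h2,
        Finset.sum_neg_distrib, ← hcu]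
      abel
    · rintro ((i | i) | i)
      · simpa using (ha i).1
      · simpa using hu0 i
      · simpa using ⟨hp.out.ne_zero, (hb i).1⟩
  have hR := hN.residue hp2 (by
    rintro (i | i)
    · exact hpd (ha i)
    · simpa using hu i)
  have h2 : (2 : ZMod p) ≠ 0 := by
    intro h0
    have : ((2 : ℕ) : ZMod p) = 0 := by exact_mod_cast h0
    rw [ZMod.natCast_eq_zero_iff, Nat.prime_dvd_prime_iff_eq hp.out Nat.prime_two] at this
    exact hp2 this
  obtain ⟨k, d, hk, hd, hprod⟩ := hR.prod_eq h2 fun i => (hb i).intCast_ne_zero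
  have hz := sum_residueClass_eq_zero hp2 (fun i => (hb i).intCast_ne_zero) hk hd hprod
  refine add_mem (sum_mem fun i _ => wittClass_mem_smoothWitt (ha i)) ?_
  rw [← toTameWitt_eq_zero_iff, map_sum, ← hz]
  exact Finset.sum_congr rfl fun i _ => tameClass_eq_residueClass (hb i)

theorem mem_smoothWitt_three {c : RatWitt} (hu : ∀ p : ℕ, p.Prime → p ≠ 2 → IsUnramified p c)
    (N : ℕ) (hc : c ∈ smoothWitt (N + 3)) : c ∈ smoothWitt 3 := by
  induction N with
  | zero => exact hc
  | succ N ih =>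
    refine ih ?_
    by_cases hN : (N + 3).Prime
    · have : Fact (N + 3).Prime := ⟨hN⟩
      have hc' : c ∈ smoothWitt (N + 3 + 1) := by rwa [show N + 3 + 1 = N + 1 + 3 by ring]
      exact mem_smoothWitt_of_isUnramified (by omega) hc' (hu _ hN (by omega))
    · refine AddSubgroup.closure_mono ?_ hc
      rintro _ ⟨n, hn, rfl⟩
      refine ⟨n, ⟨hn.1, fun q hq hqn => ?_⟩, rfl⟩
      have h1 := hn.2 q hq hqn
      have h2 : q ≠ N + 3 := fun h => hN (h ▸ hq)
      omega

theorem exists_mem_smoothWitt {ι : Type*} [Fintype ι] {u : ι → ℤ} (hu : ∀ i, u i ≠ 0) :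
    ∃ N, ∑ i, wittClass (u i) ∈ smoothWitt (N + 3) := by
  refine ⟨∑ i, (u i).natAbs, sum_mem fun i _ => wittClass_mem_smoothWitt ?_⟩
  refine isSmooth_of_abs_lt (hu i) ?_
  have := Finset.single_le_sum (f := fun i => (u i).natAbs) (fun i _ => Nat.zero_le _)
    (Finset.mem_univ i)
  rw [Int.abs_eq_natAbs]
  exact_mod_cast Nat.lt_add_right 2 (Nat.lt_succ_of_le this)

theorem wittClass_two_add_wittClass_two :
    wittClass 2 + wittClass 2 = wittClass 1 + wittClass 1 := by
  rw [wittClass_add_wittClass one_ne_zero one_ne_zero (by norm_num)]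
  norm_num

theorem eq_of_mem_smoothWitt_three {c : RatWitt} (hc : c ∈ smoothWitt 3) :
    ∃ s : ℤ, c = s • wittClass 1 ∨ c = s • wittClass 1 + wittClass 2 := by
  have h22 := wittClass_two_add_wittClass_two
  induction hc using AddSubgroup.closure_induction with
  | mem x hx =>
    obtain ⟨n, hn, rfl⟩ := hx
    have : Fact (Nat.Prime 2) := ⟨Nat.prime_two⟩
    obtain ⟨k, m, rfl, hm⟩ := exists_eq_pow_mul_isSmooth (p := 2) hn
    have hm1 : m.natAbs = 1 := by
      by_contra h
      obtain ⟨q, hq, hqm⟩ := Nat.exists_prime_and_dvd h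
      have := hm.2 q hq (Int.natCast_dvd.mpr hqm)
      have := hq.two_le
      omega
    rcases exists_wittClass_of_pow_mul (p := 2) (k := k) hm.1 with h | h <;> rw [h] <;>
      rcases Int.natAbs_eq_iff.mp hm1 with rfl | rfl
    · exact ⟨1, .inl (by simp)⟩
    · refine ⟨-1, .inl ?_⟩
      rw [neg_one_zsmul, ← wittClass_neg one_ne_zero]
      simp
    · exact ⟨0, .inr (by simp)⟩
    · refine ⟨-2, .inr ?_⟩
      have : wittClass (((2 : ℕ) : ℚ) * ((-(1 : ℕ) : ℤ) : ℚ)) = - wittClass 2 := by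
        rw [← wittClass_neg two_ne_zero]
        norm_num
      rw [this, neg_eq_iff_add_eq_zero, add_comm, add_assoc, h22]
      module
  | zero => exact ⟨0, .inl (by simp)⟩
  | add x y _ _ hx hy =>
    obtain ⟨s, rfl | rfl⟩ := hx <;> obtain ⟨t, rfl | rfl⟩ := hy
    · exact ⟨s + t, .inl (by module)⟩
    · exact ⟨s + t, .inr (by module)⟩
    · exact ⟨s + t, .inr (by module)⟩
    · refine ⟨s + t + 2, .inl ?_⟩
      calc _ = (s + t) • wittClass 1 + (wittClass 2 + wittClass 2) := by module
        _ = _ := by rw [h22]; module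
  | neg x _ hx =>
    obtain ⟨s, rfl | rfl⟩ := hx
    · exact ⟨-s, .inl (by module)⟩
    · refine ⟨-s - 2, .inr ?_⟩
      calc _ = (-s) • wittClass 1 - (wittClass 2 + wittClass 2) + wittClass 2 := by module
        _ = _ := by rw [h22]; module

theorem eq_of_isUnramified {c : RatWitt} (hu : ∀ p : ℕ, p.Prime → p ≠ 2 → IsUnramified p c) :
    ∃ s : ℤ, c = s • wittClass 1 ∨ c = s • wittClass 1 + wittClass 2 := by
  obtain ⟨ι, _, u, hu3, rfl⟩ := hu 3 Nat.prime_three (by norm_num)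
  obtain ⟨N, hN⟩ := exists_mem_smoothWitt fun i (h : u i = 0) => hu3 i (h ▸ dvd_zero _)
  exact eq_of_mem_smoothWitt_three (mem_smoothWitt_three hu N hN)

end Descent

section Signature

theorem sum_sign_eq_zero {ι : Type*} [Fintype ι] {w : ι → ℚ} (hw : ∀ i, w i ≠ 0)
    (h : Neutral w) : ∑ i, (SignType.sign (w i) : ℤ) = 0 := by
  have h1 := h.card_pos_eq_card_neg hw
  have h2 : ∀ i, (SignType.sign (w i) : ℤ) =
      (if 0 < w i then 1 else 0) - (if w i < 0 then 1 else 0) := by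
    intro i
    rcases lt_trichotomy (w i) 0 with h | h | h
    · simp [h, h.not_gt]
    · exact absurd h (hw i)
    · simp [h, h.not_gt]
  simp only [h2, Finset.sum_sub_distrib, Finset.sum_boole, h1, sub_self]

/-- The signature of a Witt class. -/
noncomputable def wittSignature : RatWitt →+ ℤ :=
  QuotientAddGroup.lift wittRelations
    (Finsupp.liftAddHom fun a : ℚ => AddMonoidHom.mulLeft (SignType.sign a : ℤ)) (by
      rintro _ ⟨ι, _, κ, _, w, u, hw, hu, nw, nu, rfl⟩
      rw [AddMonoidHom.mem_ker, map_sub, map_sum, map_sum]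
      simp [sum_sign_eq_zero hw nw, sum_sign_eq_zero hu nu])

theorem wittSignature_wittClass (a : ℚ) : wittSignature (wittClass a) = SignType.sign a := by
  simp [wittSignature, wittClass]

end Signature

section RationalIsotropy

theorem exists_isotropic_of_sum_eq {ι κ : Type} [Fintype ι] [Fintype κ] {a : ι → ℚ} {d : κ → ℚ}
    (ha : ∀ i, a i ≠ 0) (hd : ∀ i, d i ≠ 0) (h : ∑ i, wittClass (a i) = ∑ i, wittClass (d i))
    (hc : Fintype.card κ < Fintype.card ι) : ∃ x : ι → ℚ, x ≠ 0 ∧ ∑ i, a i * x i ^ 2 = 0 := by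
  refine Neutral.exists_isotropic (u := fun i => - d i) ?_ hc
  rw [← sum_wittClass_eq_zero_iff]
  · simp only [Fintype.sum_sum_type, Sum.elim_inl, Sum.elim_inr, wittClass_neg (hd _), h,
      Finset.sum_neg_distrib, add_neg_cancel]
  · rintro (i | i) <;> simp [ha, hd]

theorem exists_sum_eq_zsmul (t : ℤ) : ∃ d : Fin t.natAbs → ℚ, (∀ i, d i ≠ 0) ∧
    ∑ i, wittClass (d i) = t • wittClass 1 := by
  rcases Int.natAbs_eq t with h | h
  · refine ⟨fun _ => 1, fun _ => one_ne_zero, ?_⟩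
    conv_rhs => rw [h]
    rw [natCast_zsmul]
    simp
  · refine ⟨fun _ => -1, fun _ => neg_ne_zero.mpr one_ne_zero, ?_⟩
    conv_rhs => rw [h]
    rw [neg_zsmul, natCast_zsmul]
    simp [wittClass_neg one_ne_zero]

theorem exists_isotropic_of_sum_eq_zsmul_add {ι κ : Type} [Fintype ι] [Fintype κ] {a : ι → ℚ}
    {d : κ → ℚ} (ha : ∀ i, a i ≠ 0) (hd : ∀ i, d i ≠ 0) {t : ℤ}
    (h : ∑ i, wittClass (a i) = t • wittClass 1 + ∑ i, wittClass (d i))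
    (hc : t.natAbs + Fintype.card κ < Fintype.card ι) :
    ∃ x : ι → ℚ, x ≠ 0 ∧ ∑ i, a i * x i ^ 2 = 0 := by
  obtain ⟨d', hd', h'⟩ := exists_sum_eq_zsmul t
  refine exists_isotropic_of_sum_eq (d := Sum.elim d' d) ha ?_ ?_ (by simpa using hc)
  · rintro (i | i) <;> simp [hd, hd']
  · rw [h, ← h', Fintype.sum_sum_type]
    simp

/-- An indefinite rational diagonal form of rank at least three whose Witt class is unramified
at all odd primes is isotropic. -/
theorem exists_isotropic_of_isUnramified {ι : Type} [Fintype ι] {a : ι → ℚ} (ha : ∀ i, a i ≠ 0)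
    (h3 : 3 ≤ Fintype.card ι) (hpos : ∃ i, 0 < a i) (hneg : ∃ i, a i < 0)
    (hu : ∀ p : ℕ, p.Prime → p ≠ 2 → IsUnramified p (∑ i, wittClass (a i))) :
    ∃ x : ι → ℚ, x ≠ 0 ∧ ∑ i, a i * x i ^ 2 = 0 := by
  classical
  have habs : |∑ i, (SignType.sign (a i) : ℤ)| + 2 ≤ Fintype.card ι := by
    have key : ∀ b : ι → ℤ, (∀ i, |b i| ≤ 1) → (∃ i, b i = -1) →
        ∑ i, b i + 2 ≤ Fintype.card ι := by
      rintro b hb ⟨j, hj⟩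
      have h1 : ∀ i ∈ Finset.univ.erase j, b i ≤ 1 := fun i _ => (abs_le.mp (hb i)).2
      have h2 := Finset.sum_le_card_nsmul _ _ _ h1
      rw [Finset.card_erase_of_mem (Finset.mem_univ j), Finset.card_univ, nsmul_eq_mul, mul_one,
        Nat.cast_sub (by omega)] at h2
      rw [← Finset.add_sum_erase _ _ (Finset.mem_univ j), hj]
      push_cast at h2
      linarith
    have hs : ∀ i, |(SignType.sign (a i) : ℤ)| ≤ 1 := fun i => by
      cases SignType.sign (a i) <;> simp
    obtain ⟨i, hi⟩ := hpos
    obtain ⟨j, hj⟩ := hneg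
    have k1 := key (fun i => SignType.sign (a i)) hs ⟨j, by simp [hj]⟩
    have k2 := key (fun i => -SignType.sign (a i)) (fun i => by simpa using hs i)
      ⟨i, by simp [hi]⟩
    rw [Finset.sum_neg_distrib] at k2
    rcases abs_cases (∑ i, (SignType.sign (a i) : ℤ)) with h | h <;> omega
  obtain ⟨s, hs | hs⟩ := eq_of_isUnramified hu
  · have hsig := congrArg wittSignature hs
    simp only [map_sum, wittSignature_wittClass, map_zsmul, sign_one, SignType.coe_one, smul_eq_mul,
      mul_one] at hsig
    rw [hsig] at habs
    refine exists_isotropic_of_sum_eq_zsmul_add (κ := Empty) (d := nofun) (t := s) ha nofun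
      (hs.trans (by simp)) ?_
    rw [Fintype.card_empty]
    rcases abs_cases s with h | h <;> omega
  · have hsig := congrArg wittSignature hs
    simp only [map_sum, wittSignature_wittClass, map_zsmul, sign_one, SignType.coe_one, smul_eq_mul,
      mul_one, map_add, sign_pos two_pos] at hsig
    rw [hsig] at habs
    by_cases hs1 : -1 ≤ s
    · refine exists_isotropic_of_sum_eq_zsmul_add (κ := Unit) (d := fun _ => 2) (t := s) ha
        (by simp) (hs.trans (by simp)) ?_
      rw [Fintype.card_unit]
      rcases abs_cases (s + 1) with h | h <;> omega
    · refine exists_isotropic_of_sum_eq_zsmul_add (κ := Unit) (d := fun _ => -2) (t := s + 2) ha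
        (by simp) (hs.trans ?_) ?_
      · have h2 := wittClass_two_add_wittClass_two
        simp only [Finset.univ_unique, Finset.sum_const, Finset.card_singleton, one_smul,
          wittClass_neg two_ne_zero]
        calc s • wittClass 1 + wittClass 2 =
            s • wittClass 1 + (wittClass 2 + wittClass 2) - wittClass 2 := by module
          _ = _ := by rw [h2]; module
      · rw [Fintype.card_unit]
        rcases abs_cases (s + 1) with h | h <;> omega

end RationalIsotropy

section CongruentDiagonal

variable {K n : Type*} [Field K] [Fintype n] [DecidableEq n]

theorem isUnit_det_of_congruent {G P : Matrix n n K} {a : n → K} (ha : ∀ i, a i ≠ 0)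
    (h : Pᵀ * G * P = diagonal a) : IsUnit P.det := by
  have h1 := congrArg Matrix.det h
  rw [det_mul, det_diagonal] at h1
  exact isUnit_iff_ne_zero.mpr (right_ne_zero_of_mul
    (h1.trans_ne (Finset.prod_ne_zero_iff.mpr fun i _ => ha i)))

/-- Two diagonalizations of one form differ by a neutral form. -/
theorem neutral_of_diagonalizations {G P Q : Matrix n n K} {a b : n → K} (ha : ∀ i, a i ≠ 0)
    (hP : Pᵀ * G * P = diagonal a) (hQ : Qᵀ * G * Q = diagonal b) :
    Neutral (Sum.elim a fun i => - b i) := by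
  have hu := isUnit_det_of_congruent ha hP
  refine neutral_of_congruent (P⁻¹ * Q) ?_
  rw [← hP, ← hQ, transpose_mul, transpose_nonsing_inv]
  have e1 : (Pᵀ)⁻¹ * Pᵀ = 1 := nonsing_inv_mul _ (by rwa [det_transpose])
  have e2 : P * P⁻¹ = 1 := mul_nonsing_inv _ hu
  calc Qᵀ * (Pᵀ)⁻¹ * (Pᵀ * G * P) * (P⁻¹ * Q) = Qᵀ * ((Pᵀ)⁻¹ * Pᵀ) * G * (P * P⁻¹) * Q := by
        simp only [Matrix.mul_assoc]
    _ = Qᵀ * G * Q := by rw [e1, e2, Matrix.mul_one, Matrix.mul_one]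

theorem dotProduct_mulVec_eq_sum {G P : Matrix n n K} {a : n → K} (ha : ∀ i, a i ≠ 0)
    (hP : Pᵀ * G * P = diagonal a) (x : n → K) :
    x ⬝ᵥ G *ᵥ x = ∑ i, a i * (P⁻¹ *ᵥ x) i ^ 2 := by
  have hu := isUnit_det_of_congruent ha hP
  have hx : P *ᵥ (P⁻¹ *ᵥ x) = x := by rw [mulVec_mulVec, mul_nonsing_inv _ hu, one_mulVec]
  set z := P⁻¹ *ᵥ x
  calc x ⬝ᵥ G *ᵥ x = z ⬝ᵥ (Pᵀ * G * P) *ᵥ z := by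
        rw [← hx, ← mulVec_mulVec, ← mulVec_mulVec, dotProduct_mulVec z, vecMul_transpose]
    _ = _ := by
        rw [hP]
        simp only [dotProduct, mulVec_diagonal]
        exact Finset.sum_congr rfl fun i _ => by ring

end CongruentDiagonal

section BilinearLattice

variable {M : Type*} [AddCommGroup M] {B : LinearMap.BilinForm ℤ M}

/-- The coordinates of an orthogonal family diagonalize the Gram matrix. -/
theorem exists_diagonalization (K : Type*) [Field K] {n : Type*} [Fintype n] [DecidableEq n]
    (b : Module.Basis n ℤ M) {v : n → M} (hv : ∀ i j, i ≠ j → B (v i) (v j) = 0) :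
    ∃ P : Matrix n n K, Pᵀ * ((LinearMap.BilinForm.toMatrix b B).map (Int.cast : ℤ → K)) * P =
      diagonal fun i => (B (v i) (v i) : K) := by
  have h : (b.toMatrix v)ᵀ * LinearMap.BilinForm.toMatrix b B * b.toMatrix v =
      diagonal fun i => B (v i) (v i) := by
    ext i j
    have h1 : ((b.toMatrix v)ᵀ * LinearMap.BilinForm.toMatrix b B * b.toMatrix v) i j =
        B (v i) (v j) := by
      rw [LinearMap.BilinForm.apply_eq_dotProduct_toMatrix_mulVec b, Matrix.mul_assoc]
      rfl
    rw [h1, diagonal_apply]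
    split_ifs with hij
    · rw [hij]
    · exact hv i j hij
  refine ⟨(b.toMatrix v).map (Int.castRingHom K), ?_⟩
  have h2 := congrArg (fun A => A.map (Int.castRingHom K)) h
  simp only [Matrix.map_mul, transpose_map] at h2
  refine h2.trans ?_
  rw [diagonal_map (map_zero _)]
  rfl

/-- The form is nondegenerate modulo `p`. -/
def NondegMod (p : ℕ) (B : LinearMap.BilinForm ℤ M) : Prop :=
  ∀ x, (∀ y, (p : ℤ) ∣ B x y) → ∃ z, x = (p : ℤ) • z

theorem exists_not_dvd_apply_self {p : ℕ} (hp : p.Prime) (hp2 : p ≠ 2)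
    (hB : ∀ x y, B x y = B y x) {x y : M} (h : ¬ (p : ℤ) ∣ B x y) : ∃ v, ¬ (p : ℤ) ∣ B v v := by
  by_contra! hall
  have h1 := hall (x + y)
  simp only [map_add, LinearMap.add_apply, hB y x] at h1
  have h2 : (p : ℤ) ∣ 2 * B x y := by
    have := dvd_sub (dvd_sub h1 (hall x)) (hall y)
    rwa [show B x x + B x y + (B x y + B y y) - B x x - B y y = 2 * B x y by ring] at this
  rcases Int.Prime.dvd_mul' hp h2 with h3 | h3
  · have := (Nat.prime_dvd_prime_iff_eq hp Nat.prime_two).mp (by exact_mod_cast h3)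
    exact hp2 this
  · exact h h3

theorem finrank_ker_add_one [Module.Free ℤ M] [Module.Finite ℤ M] {f : M →ₗ[ℤ] ℤ} (hf : f ≠ 0) :
    Module.finrank ℤ (LinearMap.ker f) + 1 = Module.finrank ℤ M := by
  rw [← Submodule.finrank_quotient_add_finrank (LinearMap.ker f), add_comm,
    f.quotKerEquivRange.finrank_eq]
  congr 1
  have h1 : Module.finrank ℤ (LinearMap.range f) ≤ 1 := by
    simpa using Submodule.finrank_le (LinearMap.range f)
  have h2 : 0 < Module.finrank ℤ (LinearMap.range f) := by
    have : Nontrivial (LinearMap.range f) := by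
      rw [Submodule.nontrivial_iff_ne_bot, Ne, LinearMap.range_eq_bot]
      exact hf
    exact Module.finrank_pos
  omega

end BilinearLattice

theorem exists_orthogonal_family {p : ℕ} (hp : p.Prime) (hp2 : p ≠ 2) (n : ℕ) :
    ∀ {M : Type*} [AddCommGroup M] [Module.Free ℤ M] [Module.Finite ℤ M]
      {B : LinearMap.BilinForm ℤ M}, (∀ x y, B x y = B y x) → NondegMod p B →
      Module.finrank ℤ M = n → ∃ v : Fin n → M, (∀ i j, i ≠ j → B (v i) (v j) = 0) ∧
        ∀ i, ¬ (p : ℤ) ∣ B (v i) (v i) := by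
  induction n with
  | zero => exact fun _ _ _ => ⟨fun _ => 0, fun i => i.elim0, fun i => i.elim0⟩
  | succ n ih =>
    intro M _ _ _ B hB hN hn
    obtain ⟨x, hx⟩ : ∃ x : M, ∀ z, x ≠ (p : ℤ) • z := by
      have b := Module.finBasisOfFinrankEq ℤ M hn
      refine ⟨b 0, fun z hz => ?_⟩
      have h1 := congrArg (fun y => b.repr y 0) hz
      simp only [Module.Basis.repr_self, Finsupp.single_eq_same, map_smul, Finsupp.smul_apply,
        smul_eq_mul] at h1
      have h2 := Int.eq_one_or_neg_one_of_mul_eq_one h1.symm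
      have := hp.two_le
      omega
    have hy : ∃ y, ¬ (p : ℤ) ∣ B x y := by
      by_contra! h
      obtain ⟨z, hz⟩ := hN x h
      exact hx z hz
    obtain ⟨y, hy⟩ := hy
    obtain ⟨v, hv⟩ := exists_not_dvd_apply_self hp hp2 hB hy
    have hv0 : B v ≠ 0 := by
      intro h
      rw [h] at hv
      exact hv (by simp)
    let K := LinearMap.ker (B v)
    have hK : Module.finrank ℤ K = n := Nat.succ.inj ((finrank_ker_add_one hv0).trans hn)
    obtain ⟨w, hw, hwp⟩ := ih (M := K) (B := B.restrict K) (fun x y => hB x y) (by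
      rintro ⟨x, hx⟩ hall
      have hx' : B v x = 0 := hx
      obtain ⟨z, hz⟩ := hN x (fun m => by
        have hm : B v v • m - B v m • v ∈ K := by
          simp only [K, LinearMap.mem_ker, map_sub, map_smul, smul_eq_mul]
          ring
        have h1 : (p : ℤ) ∣ B x (B v v • m - B v m • v) := hall ⟨_, hm⟩
        rw [map_sub, map_smul, map_smul, hB x v, hx', smul_zero, sub_zero, smul_eq_mul] at h1
        exact (Int.Prime.dvd_mul' hp h1).resolve_left hv)
      refine ⟨⟨z, ?_⟩, Subtype.ext hz⟩
      rw [hz, map_smul, smul_eq_mul] at hx'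
      exact (mul_eq_zero.mp hx').resolve_left (by exact_mod_cast hp.ne_zero)) hK
    refine ⟨Fin.cons v fun i => (w i : M), ?_, ?_⟩
    · intro i j
      have h0 : ∀ i, B v (w i) = 0 := fun i => (w i).2
      refine Fin.cases ?_ (fun i => ?_) i <;> refine Fin.cases ?_ (fun j => ?_) j
      · exact fun h => absurd rfl h
      · exact fun _ => h0 j
      · exact fun _ => (hB _ _).trans (h0 i)
      · exact fun h => hw i j fun e => h (congrArg Fin.succ e)
    · intro i
      refine Fin.cases ?_ (fun i => ?_) i
      · exact hv
      · exact hwp i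

section Isotropy

variable {M : Type*} [AddCommGroup M] {B : LinearMap.BilinForm ℤ M}

theorem exists_pos_of_apply_pos {K n : Type*} [Field K] [LinearOrder K] [IsStrictOrderedRing K]
    [Fintype n] [DecidableEq n] {b : Module.Basis n ℤ M} {P : Matrix n n K} {a : n → K}
    (ha : ∀ i, a i ≠ 0)
    (hP : Pᵀ * ((LinearMap.BilinForm.toMatrix b B).map (Int.cast : ℤ → K)) * P = diagonal a)
    {x : M} (hx : 0 < B x x) : ∃ i, 0 < a i := by
  by_contra! h
  have h1 := dotProduct_mulVec_eq_sum ha hP (fun i => (b.repr x i : K))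
  have h2 : (fun i => (b.repr x i : K)) ⬝ᵥ
      ((LinearMap.BilinForm.toMatrix b B).map (Int.cast : ℤ → K)) *ᵥ
        (fun i => (b.repr x i : K)) = (B x x : K) := by
    rw [LinearMap.BilinForm.apply_eq_dotProduct_toMatrix_mulVec b]
    simp [dotProduct, mulVec]
  have h3 : (0 : K) < B x x := by exact_mod_cast hx
  rw [← h2, h1] at h3
  exact absurd h3 (not_lt.mpr (Finset.sum_nonpos fun i _ =>
    mul_nonpos_of_nonpos_of_nonneg (h i) (sq_nonneg _)))

theorem exists_neg_of_apply_neg {K n : Type*} [Field K] [LinearOrder K] [IsStrictOrderedRing K]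
    [Fintype n] [DecidableEq n] {b : Module.Basis n ℤ M} {P : Matrix n n K} {a : n → K}
    (ha : ∀ i, a i ≠ 0)
    (hP : Pᵀ * ((LinearMap.BilinForm.toMatrix b B).map (Int.cast : ℤ → K)) * P = diagonal a)
    {x : M} (hx : B x x < 0) : ∃ i, a i < 0 := by
  have hP' : Pᵀ * ((LinearMap.BilinForm.toMatrix b (-B)).map (Int.cast : ℤ → K)) * P =
      diagonal fun i => - a i := by
    rw [← diagonal_neg, ← hP, ← Matrix.neg_mul, ← Matrix.mul_neg]
    congr 2
    ext i j
    simp [LinearMap.BilinForm.toMatrix_apply]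
  obtain ⟨i, hi⟩ := exists_pos_of_apply_pos (x := x) (fun i => neg_ne_zero.mpr (ha i)) hP'
    (by simpa using hx)
  exact ⟨i, by simpa using hi⟩

/-- An indefinite lattice of rank at least three that is nondegenerate modulo all odd primes
is isotropic. -/
theorem exists_isotropic [Module.Free ℤ M] [Module.Finite ℤ M] (hB : ∀ x y, B x y = B y x)
    (h3 : 3 ≤ Module.finrank ℤ M) (hN : ∀ p : ℕ, p.Prime → p ≠ 2 → NondegMod p B)
    (hpos : ∃ x, 0 < B x x) (hneg : ∃ x, B x x < 0) : ∃ x, x ≠ 0 ∧ B x x = 0 := by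
  let b := Module.finBasis ℤ M
  have hfam : ∀ p : ℕ, p.Prime → p ≠ 2 → ∃ v : Fin (Module.finrank ℤ M) → M,
      (∀ i j, i ≠ j → B (v i) (v j) = 0) ∧ ∀ i, ¬ (p : ℤ) ∣ B (v i) (v i) :=
    fun p hp hp2 => exists_orthogonal_family hp hp2 _ hB (hN p hp hp2) rfl
  obtain ⟨v, hv, hv3⟩ := hfam 3 Nat.prime_three (by norm_num)
  have hv0 : ∀ i, B (v i) (v i) ≠ 0 := fun i h => hv3 i (h ▸ dvd_zero _)
  have hv0' : ∀ i, (B (v i) (v i) : ℚ) ≠ 0 := fun i => by exact_mod_cast hv0 i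
  obtain ⟨P, hP⟩ := exists_diagonalization ℚ b hv
  obtain ⟨x, hx, hx0⟩ := exists_isotropic_of_isUnramified hv0' (by simpa using h3)
    (hpos.elim fun x hx => exists_pos_of_apply_pos hv0' hP hx)
    (hneg.elim fun x hx => exists_neg_of_apply_neg hv0' hP hx) (by
      intro p hp hp2
      obtain ⟨w, hw, hwp⟩ := hfam p hp hp2
      have hw0 : ∀ i, (B (w i) (w i) : ℚ) ≠ 0 := fun i => by
        have : B (w i) (w i) ≠ 0 := fun h => hwp i (h ▸ dvd_zero _)
        exact_mod_cast this
      obtain ⟨Q, hQ⟩ := exists_diagonalization ℚ b hw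
      refine ⟨_, inferInstance, fun i => B (w i) (w i), hwp, ?_⟩
      have hneu := neutral_of_diagonalizations hv0' hP hQ
      have hne : ∀ i,
          Sum.elim (fun i => (B (v i) (v i) : ℚ)) (fun i => -(B (w i) (w i) : ℚ)) i ≠ 0 := by
        rintro (i | i)
        · exact hv0' i
        · exact neg_ne_zero.mpr (hw0 i)
      rw [← sum_wittClass_eq_zero_iff hne] at hneu
      simp only [Fintype.sum_sum_type, Sum.elim_inl, Sum.elim_inr, wittClass_neg (hw0 _),
        Finset.sum_neg_distrib] at hneu
      exact add_neg_eq_zero.mp hneu)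
  obtain ⟨d, hd⟩ := IsLocalization.exist_integer_multiples_of_finite (nonZeroDivisors ℤ) x
  choose y hy using hd
  have hd0 : ((d : ℤ) : ℚ) ≠ 0 := by exact_mod_cast nonZeroDivisors.coe_ne_zero d
  replace hy : ∀ i, (y i : ℚ) = (d : ℤ) * x i := fun i => (hy i).trans (zsmul_eq_mul _ _)
  have hBv : ∀ i, B (∑ j, y j • v j) (v i) = y i * B (v i) (v i) := by
    intro i
    rw [map_sum, LinearMap.sum_apply, Finset.sum_eq_single i]
    · simp
    · intro j _ hj
      simp [hv j i hj]
    · simp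
  refine ⟨∑ i, y i • v i, ?_, ?_⟩
  · obtain ⟨i, hi⟩ := Function.ne_iff.mp hx
    intro h0
    have h1 := hBv i
    rw [h0, map_zero, LinearMap.zero_apply] at h1
    have h2 := (mul_eq_zero.mp h1.symm).resolve_right (hv0 i)
    have h3 := hy i
    rw [h2, Int.cast_zero] at h3
    exact hi ((mul_eq_zero.mp h3.symm).resolve_left hd0)
  · rw [map_sum]
    simp only [map_smul, hBv, smul_eq_mul]
    have h1 : ((∑ i, y i * (y i * B (v i) (v i)) : ℤ) : ℚ) = 0 := by
      have h2 : (d : ℤ) ^ 2 * ∑ i, (B (v i) (v i) : ℚ) * x i ^ 2 = 0 := by rw [hx0, mul_zero]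
      rw [← h2, Finset.mul_sum]
      push_cast
      refine Finset.sum_congr rfl fun i _ => ?_
      rw [hy i]
      ring
    exact_mod_cast h1

end Isotropy

section Unimodular

variable {M : Type*} [AddCommGroup M] {B : LinearMap.BilinForm ℤ M}

/-- A form identifying the lattice with its dual. -/
def Unimodular (B : LinearMap.BilinForm ℤ M) : Prop :=
  (∀ x, B x = 0 → x = 0) ∧ ∀ f : M →ₗ[ℤ] ℤ, ∃ x, B x = f

theorem exists_eq_smul_of_dvd {f : M →ₗ[ℤ] ℤ} {d : ℤ} (hd : d ≠ 0) (h : ∀ y, d ∣ f y) :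
    ∃ g : M →ₗ[ℤ] ℤ, f = d • g := by
  choose g hg using h
  refine ⟨AddMonoidHom.toIntLinearMap (AddMonoidHom.mk' g fun x y => ?_), ?_⟩
  · have := map_add f x y
    rw [hg, hg, hg, ← mul_add] at this
    exact mul_left_cancel₀ hd this
  · ext x
    exact hg x

/-- A nonzero functional is a multiple of a surjective one. -/
theorem exists_eq_smul_surjective {f : M →ₗ[ℤ] ℤ} (hf : f ≠ 0) :
    ∃ (d : ℤ) (g : M →ₗ[ℤ] ℤ) (y : M), d ≠ 0 ∧ f = d • g ∧ g y = 1 := by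
  obtain ⟨d, hd⟩ := (IsPrincipalIdealRing.principal (LinearMap.range f)).principal
  have hd0 : d ≠ 0 := by
    rintro rfl
    rw [Submodule.span_zero_singleton, LinearMap.range_eq_bot] at hd
    exact hf hd
  obtain ⟨g, hg⟩ := exists_eq_smul_of_dvd (f := f) hd0 fun y => by
    have : f y ∈ LinearMap.range f := ⟨y, rfl⟩
    rw [hd] at this
    exact Ideal.mem_span_singleton.mp this
  obtain ⟨y, hy⟩ : d ∈ LinearMap.range f := hd ▸ Submodule.mem_span_singleton_self d
  refine ⟨d, g, y, hd0, hg, ?_⟩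
  rw [hg] at hy
  exact mul_left_cancel₀ hd0 (hy.trans (mul_one d).symm)

theorem Unimodular.nondegMod (hU : Unimodular B) {p : ℕ} (hp : p.Prime) : NondegMod p B := by
  intro x hx
  obtain ⟨g, hg⟩ := exists_eq_smul_of_dvd (by exact_mod_cast hp.ne_zero) hx
  obtain ⟨z, rfl⟩ := hU.2 g
  refine ⟨z, sub_eq_zero.mp (hU.1 _ ?_)⟩
  rw [map_sub, hg, map_smul, sub_self]

theorem Unimodular.exists_hyperbolic (hU : Unimodular B) {x : M} (hx : x ≠ 0) (h0 : B x x = 0) :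
    ∃ e f, B e e = 0 ∧ B e f = 1 := by
  obtain ⟨d, g, y, hd, hg, hy⟩ := exists_eq_smul_surjective fun h => hx (hU.1 x h)
  obtain ⟨e, rfl⟩ := hU.2 g
  have hxe : x = d • e := sub_eq_zero.mp (hU.1 _ (by rw [map_sub, hg, map_smul, sub_self]))
  refine ⟨e, y, ?_, hy⟩
  rw [hxe] at h0
  simpa [hd] using h0

theorem Unimodular.exists_apply_self_ne_zero (hU : Unimodular B) (hB : ∀ x y, B x y = B y x)
    {x : M} (hx : x ≠ 0) : ∃ v, B v v ≠ 0 := by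
  by_contra! h
  refine hx (hU.1 x (LinearMap.ext fun y => ?_))
  have h1 := h (x + y)
  simp only [map_add, LinearMap.add_apply, h, hB y x] at h1
  rw [LinearMap.zero_apply]
  omega

/-- The orthogonal complement of a vector of norm `±1` in a unimodular lattice is unimodular. -/
theorem Unimodular.ker (hU : Unimodular B) (hB : ∀ x y, B x y = B y x) {v : M}
    (hv : B v v * B v v = 1) : Unimodular (B.restrict (LinearMap.ker (B v))) := by
  have hmem : ∀ x, x - (B v v * B v x) • v ∈ LinearMap.ker (B v) := by
    intro x
    rw [LinearMap.mem_ker, map_sub, map_smul, smul_eq_mul]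
    linear_combination (-B v x) * hv
  refine ⟨fun x hx => ?_, fun f => ?_⟩
  · refine Subtype.ext (hU.1 _ (LinearMap.ext fun y => ?_))
    have h1 : B x (y - (B v v * B v y) • v) = 0 := LinearMap.congr_fun hx ⟨_, hmem y⟩
    have h2 : B v x = 0 := x.2
    rw [map_sub, map_smul, hB x v, h2, smul_zero, sub_zero] at h1
    exact h1
  · let g : M →ₗ[ℤ] ℤ := f ∘ₗ
      (LinearMap.id - (B v v • B v).smulRight v).codRestrict (LinearMap.ker (B v)) (fun x => by
        simpa using hmem x)
    obtain ⟨z, hz⟩ := hU.2 g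
    have hg : ∀ x (hx : B v x = 0), g x = f ⟨x, hx⟩ := by
      intro x hx
      refine congrArg f (Subtype.ext ?_)
      simp [hx]
    have hgv : g v = 0 := by
      have : (LinearMap.id - (B v v • B v).smulRight v).codRestrict (LinearMap.ker (B v))
        (fun x => by simpa using hmem x) v = 0 := Subtype.ext (by simp [hv])
      change f _ = 0
      rw [this, map_zero]
    have hzv : B v z = 0 := by rw [hB, hz, hgv]
    refine ⟨⟨z, hzv⟩, LinearMap.ext fun y => ?_⟩
    rw [← hg y y.2, ← hz]
    rfl

end Unimodular

section UnitFamily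

/-- An orthogonal family of vectors of norm `±1` spanning the lattice. -/
structure UnitFamily {M ι : Type*} [AddCommGroup M] (B : LinearMap.BilinForm ℤ M) (v : ι → M) :
    Prop where
  orthogonal : ∀ i j, i ≠ j → B (v i) (v j) = 0
  norm : ∀ i, B (v i) (v i) = 1 ∨ B (v i) (v i) = -1
  complete : ∀ x, (∀ i, B (v i) x = 0) → x = 0

theorem mul_self_eq_one_of_eq {a : ℤ} (h : a = 1 ∨ a = -1) : a * a = 1 := by
  rcases h with h | h <;> simp [h]

variable {M : Type*} [AddCommGroup M] {B : LinearMap.BilinForm ℤ M}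

theorem UnitFamily.cons (hB : ∀ x y, B x y = B y x) {n : ℕ} {v : M}
    (hv : B v v = 1 ∨ B v v = -1)
    {w : Fin n → LinearMap.ker (B v)} (hw : UnitFamily (B.restrict (LinearMap.ker (B v))) w) :
    UnitFamily B (Fin.cons v (fun i => (w i : M)) : Fin (n + 1) → M) := by
  have h0 : ∀ i, B v (w i) = 0 := fun i => (w i).2
  refine ⟨fun i j => ?_, fun i => ?_, fun x hx => ?_⟩
  · refine Fin.cases ?_ (fun i => ?_) i <;> refine Fin.cases ?_ (fun j => ?_) j
    · exact fun h => absurd rfl h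
    · exact fun _ => h0 j
    · exact fun _ => (hB _ _).trans (h0 i)
    · exact fun h => hw.orthogonal i j fun e => h (congrArg Fin.succ e)
  · refine Fin.cases hv (fun i => hw.norm i) i
  · exact congrArg Subtype.val (hw.complete ⟨x, hx 0⟩ fun i => hx i.succ)

theorem UnitFamily.eq_sum {ι : Type*} [Fintype ι] {v : ι → M} (hv : UnitFamily B v) (x : M) :
    x = ∑ i, (B (v i) (v i) * B (v i) x) • v i := by
  rw [← sub_eq_zero]
  refine hv.complete _ fun j => ?_
  rw [map_sub, map_sum, Finset.sum_eq_single j]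
  · rw [map_smul, smul_eq_mul]
    linear_combination (-B (v j) x) * mul_self_eq_one_of_eq (hv.norm j)
  · intro i _ hij
    rw [map_smul, hv.orthogonal j i hij.symm, smul_zero]
  · simp

theorem UnitFamily.apply_sum {M' : Type*} [AddCommGroup M'] {B' : LinearMap.BilinForm ℤ M'}
    {ι : Type*} [Fintype ι] {v : ι → M} {v' : ι → M'} (hv' : UnitFamily B' v')
    (h : ∀ i, B (v i) (v i) = B' (v' i) (v' i)) (x : M) (j : ι) :
    B' (v' j) (∑ i, (B (v i) (v i) * B (v i) x) • v' i) = B (v j) x := by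
  rw [map_sum, Finset.sum_eq_single j]
  · rw [map_smul, smul_eq_mul, h]
    linear_combination (B (v j) x) * mul_self_eq_one_of_eq (hv'.norm j)
  · intro i _ hij
    rw [map_smul, hv'.orthogonal j i hij.symm, smul_zero]
  · simp

/-- Lattices with unit families of the same norms are isometric. -/
theorem UnitFamily.exists_isometry {M' : Type*} [AddCommGroup M'] {B' : LinearMap.BilinForm ℤ M'}
    {ι : Type*} [Fintype ι] {v : ι → M} {v' : ι → M'} (hv : UnitFamily B v)
    (hv' : UnitFamily B' v') (h : ∀ i, B (v i) (v i) = B' (v' i) (v' i)) :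
    ∃ σ : M ≃ₗ[ℤ] M', ∀ x y, B' (σ x) (σ y) = B x y := by
  have hl : ∀ x, ∑ i, (B' (v' i) (v' i) * B' (v' i) (∑ i, (B (v i) (v i) * B (v i) x) • v' i)) •
      v i = x := by
    intro x
    simp only [hv'.apply_sum h x, ← h]
    exact (hv.eq_sum x).symm
  have hr : ∀ y, ∑ i, (B (v i) (v i) * B (v i) (∑ i, (B' (v' i) (v' i) * B' (v' i) y) • v i)) •
      v' i = y := by
    intro y
    simp only [hv.apply_sum (fun i => (h i).symm) y, h]
    exact (hv'.eq_sum y).symm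
  refine ⟨{ toFun := fun x => ∑ i, (B (v i) (v i) * B (v i) x) • v' i
            invFun := fun y => ∑ i, (B' (v' i) (v' i) * B' (v' i) y) • v i
            map_add' := fun x y => by simp [mul_add, add_smul, Finset.sum_add_distrib]
            map_smul' := fun c x => by
              simp only [map_smul, smul_eq_mul, mul_left_comm _ c, mul_smul, Finset.smul_sum]
              rfl
            left_inv := hl
            right_inv := hr }, fun x y => ?_⟩
  change B' (∑ i, (B (v i) (v i) * B (v i) x) • v' i)
    (∑ i, (B (v i) (v i) * B (v i) y) • v' i) = B x y
  conv_rhs => rw [hv.eq_sum x]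
  simp only [map_sum B', map_sum B, LinearMap.sum_apply, map_smul, LinearMap.smul_apply,
    hv'.apply_sum h y]

end UnitFamily

section OddUnimodular

variable {M : Type*} [AddCommGroup M] {B : LinearMap.BilinForm ℤ M}

/-- An odd isotropic unimodular lattice contains orthogonal vectors of norms `1` and `-1`. -/
theorem Unimodular.exists_unit_pair (hU : Unimodular B) (hB : ∀ x y, B x y = B y x) {x o : M}
    (hx : x ≠ 0) (h0 : B x x = 0) (ho : Odd (B o o)) :
    ∃ y z, B y y = 1 ∧ B z z = -1 ∧ B y z = 0 := by
  obtain ⟨e, f, he, hef⟩ := hU.exists_hyperbolic hx h0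
  obtain ⟨y, hy, k, hk⟩ : ∃ y, B e y = 1 ∧ Odd (B y y) := by
    rcases Int.even_or_odd (B f f) with ⟨m, hm⟩ | hf
    · refine ⟨o + (1 - B e o) • f, ?_, ?_⟩
      · simp [hef]
      · obtain ⟨k, hk⟩ := ho
        refine ⟨k + (1 - B e o) * B o f + (1 - B e o) ^ 2 * m, ?_⟩
        simp only [map_add, map_smul, LinearMap.add_apply, LinearMap.smul_apply, smul_eq_mul,
          hB f o, hk, hm]
        ring
    · exact ⟨f, hef, hf⟩
  refine ⟨y - k • e, y - k • e - e, ?_, ?_, ?_⟩ <;>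
  · simp only [map_sub, map_smul, LinearMap.sub_apply, LinearMap.smul_apply, smul_eq_mul,
      hB y e, hy, he, hk]
    ring

theorem exists_norm_one_of_finrank_eq_one [Module.Free ℤ M] [Module.Finite ℤ M]
    (hU : Unimodular B) (h1 : Module.finrank ℤ M = 1) : ∃ v, B v v = 1 ∨ B v v = -1 := by
  have b := Module.finBasisOfFinrankEq ℤ M h1
  obtain ⟨x, hx⟩ := hU.2 (b.coord 0)
  have hx0 : B x (b 0) = 1 := by simp [hx]
  rw [← b.sum_repr x] at hx0
  simp only [Fin.sum_univ_one, map_smul, LinearMap.smul_apply, smul_eq_mul] at hx0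
  exact ⟨b 0, Int.eq_one_or_neg_one_of_mul_eq_one ((mul_comm _ _).trans hx0)⟩

end OddUnimodular

theorem exists_unitFamily (n : ℕ) :
    ∀ {M : Type*} [AddCommGroup M] [Module.Free ℤ M] [Module.Finite ℤ M]
      {B : LinearMap.BilinForm ℤ M}, (∀ x y, B x y = B y x) → Unimodular B →
      Module.finrank ℤ M = n → (0 < n → ∃ v, B v v = 1 ∨ B v v = -1) →
      (3 ≤ n → (∃ x, 0 < B x x) ∧ ∃ x, B x x < 0) → ∃ v : Fin n → M, UnitFamily B v := by
  induction n with
  | zero =>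
    intro M _ _ _ B _ _ hn _ _
    have : Subsingleton M := Module.finrank_zero_iff.mp hn
    exact ⟨fun _ => 0, fun i => i.elim0, fun i => i.elim0, fun x _ => Subsingleton.elim _ _⟩
  | succ n ih =>
    intro M _ _ _ B hB hU hn h1 h3
    have hrank : ∀ v, B v v = 1 ∨ B v v = -1 → Module.finrank ℤ (LinearMap.ker (B v)) = n := by
      intro v hv
      have hv0 : B v ≠ 0 := by
        intro h
        rw [h] at hv
        simp at hv
      exact Nat.succ.inj ((finrank_ker_add_one hv0).trans hn)
    suffices h : ∃ v, (B v v = 1 ∨ B v v = -1) ∧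
        (0 < n → ∃ w : LinearMap.ker (B v), B w w = 1 ∨ B w w = -1) ∧
        (3 ≤ n → (∃ x : LinearMap.ker (B v), 0 < B x x) ∧
          ∃ x : LinearMap.ker (B v), B x x < 0) by
      obtain ⟨v, hv, hv1, hv3⟩ := h
      obtain ⟨w, hw⟩ := ih (M := LinearMap.ker (B v)) (B := B.restrict (LinearMap.ker (B v)))
        (fun x y => hB x y) (hU.ker hB (mul_self_eq_one_of_eq hv)) (hrank v hv) hv1 hv3
      exact ⟨_, UnitFamily.cons hB hv hw⟩
    obtain ⟨v, hv⟩ := h1 n.succ_pos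
    by_cases hn2 : n < 2
    · refine ⟨v, hv, fun hn0 => ?_, fun h => by omega⟩
      exact exists_norm_one_of_finrank_eq_one (M := LinearMap.ker (B v))
        (hU.ker hB (mul_self_eq_one_of_eq hv)) ((hrank v hv).trans (by omega))
    have hind := h3 (by omega)
    obtain ⟨x, hx, hx0⟩ := exists_isotropic hB (by omega)
      (fun p hp _ => hU.nondegMod hp) hind.1 hind.2
    obtain ⟨y, z, hy, hz, hyz⟩ := hU.exists_unit_pair hB hx hx0 (o := v)
      (by rcases hv with h | h <;> rw [h] <;> decide)
    by_cases hpos : ∃ x : LinearMap.ker (B y), 0 < B x x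
    · exact ⟨y, .inl hy, fun _ => ⟨⟨z, hyz⟩, .inr hz⟩,
        fun _ => ⟨hpos, ⟨z, hyz⟩, by change B z z < 0; omega⟩⟩
    by_cases hneg : ∃ x : LinearMap.ker (B z), B x x < 0
    · have hzy : B z y = 0 := (hB z y).trans hyz
      exact ⟨z, .inr hz, fun _ => ⟨⟨y, hzy⟩, .inl hy⟩,
        fun _ => ⟨⟨⟨y, hzy⟩, by change 0 < B y y; omega⟩, hneg⟩⟩
    refine ⟨y, .inl hy, fun _ => ⟨⟨z, hyz⟩, .inr hz⟩, fun hn3 => ?_⟩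
    exfalso
    have hUy : Unimodular (B.restrict (LinearMap.ker (B y))) := hU.ker hB (by rw [hy]; rfl)
    let z' : LinearMap.ker (B y) := ⟨z, hyz⟩
    have hz' : B.restrict (LinearMap.ker (B y)) z' z' = -1 := hz
    have hUz := hUy.ker (fun a b => hB a b) (v := z') (by rw [hz']; rfl)
    have hne : B.restrict (LinearMap.ker (B y)) z' ≠ 0 := by
      intro h
      rw [h] at hz'
      simp at hz'
    have hr : Module.finrank ℤ (LinearMap.ker (B.restrict (LinearMap.ker (B y)) z')) + 1 = n :=
      (finrank_ker_add_one hne).trans (hrank y (.inl hy))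
    have : Nontrivial (LinearMap.ker (B.restrict (LinearMap.ker (B y)) z')) :=
      Module.nontrivial_of_finrank_pos (R := ℤ)
        (Nat.lt_of_lt_of_eq (by omega : 0 < n - 1) (Nat.eq_sub_of_add_eq hr).symm)
    obtain ⟨t, ht⟩ := exists_ne (0 : LinearMap.ker (B.restrict (LinearMap.ker (B y)) z'))
    obtain ⟨u, hu⟩ := hUz.exists_apply_self_ne_zero (fun a b => hB a b) ht
    have hu' : B u.1.1 u.1.1 ≠ 0 := hu
    rcases lt_or_gt_of_ne hu' with h | h
    · exact hneg ⟨⟨u.1.1, u.2⟩, h⟩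
    · exact hpos ⟨u.1, h⟩

section OddForm

variable {M : Type*} [AddCommGroup M] {B : LinearMap.BilinForm ℤ M} {e f : M}

/-- A standard basis of a hyperbolic plane in a lattice. -/
structure HyperbolicPair (B : LinearMap.BilinForm ℤ M) (e f : M) : Prop where
  left : B e e = 0
  right : B f f = 0
  apply : B e f = 1

theorem Unimodular.exists_hyperbolicPair (hU : Unimodular B) (hB : ∀ x y, B x y = B y x)
    (hE : ∀ x, Even (B x x)) {x : M} (hx : x ≠ 0) (h0 : B x x = 0) :
    ∃ e f, HyperbolicPair B e f := by
  obtain ⟨e, f, he, hef⟩ := hU.exists_hyperbolic hx h0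
  obtain ⟨k, hk⟩ := hE f
  refine ⟨e, f - k • e, he, ?_, ?_⟩ <;>
  · simp only [map_sub, map_smul, LinearMap.sub_apply, LinearMap.smul_apply, smul_eq_mul,
      hB f e, he, hef, hk]
    ring

/-- The form obtained from `B` by replacing the hyperbolic plane spanned by `e` and `f` by the
odd plane in which `e` and `f` are orthogonal of norms `1` and `-1`. -/
def oddForm (B : LinearMap.BilinForm ℤ M) (e f : M) : LinearMap.BilinForm ℤ M :=
  B ∘ₗ (LinearMap.id - (B f + B e).smulRight e + (B f - B e).smulRight f)

theorem oddForm_apply (B : LinearMap.BilinForm ℤ M) (e f x y : M) :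
    oddForm B e f x y = B x y - (B f x + B e x) * B e y + (B f x - B e x) * B f y := by
  simp [oddForm]

theorem oddForm_comm (hB : ∀ x y, B x y = B y x) (x y : M) :
    oddForm B e f x y = oddForm B e f y x := by
  rw [oddForm_apply, oddForm_apply, hB y x]
  ring

theorem HyperbolicPair.unimodular_oddForm (h : HyperbolicPair B e f)
    (hB : ∀ x y, B x y = B y x) (hU : Unimodular B) : Unimodular (oddForm B e f) := by
  have hfe := (hB f e).trans h.apply
  refine ⟨fun x hx => ?_, fun g => ?_⟩
  · have h1 := hU.1 _ hx
    have h2 : ∀ y, oddForm B e f x y = 0 := fun y => by rw [hx, LinearMap.zero_apply]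
    have he := h2 e
    have hf := h2 f
    simp only [oddForm_apply, h.left, h.right, h.apply, hfe, hB x e, hB x f] at he hf
    have he0 : B e x = 0 := by linarith
    have hf0 : B f x = 0 := by linarith
    simpa [he0, hf0] using h1
  · obtain ⟨z, rfl⟩ := hU.2 g
    refine ⟨z + (B e z - B f z) • e - (B f z + B e z) • f, LinearMap.ext fun y => ?_⟩
    simp only [oddForm_apply, map_add, map_sub, map_smul, LinearMap.add_apply,
      LinearMap.sub_apply, LinearMap.smul_apply, smul_eq_mul, h.left, h.right, h.apply, hfe]
    ring

/-- An embedding scaling the even form to four times the odd form. -/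
def toOdd (B : LinearMap.BilinForm ℤ M) (e f : M) : M →ₗ[ℤ] M :=
  (2 : ℤ) • LinearMap.id + ((2 : ℤ) • B e - B f).smulRight e + (B f - (4 : ℤ) • B e).smulRight f

theorem toOdd_apply (B : LinearMap.BilinForm ℤ M) (e f x : M) :
    toOdd B e f x = (2 : ℤ) • x + (2 * B e x - B f x) • e + (B f x - 4 * B e x) • f :=
  rfl

theorem HyperbolicPair.oddForm_toOdd (h : HyperbolicPair B e f) (hB : ∀ x y, B x y = B y x)
    (x y : M) : oddForm B e f (toOdd B e f x) (toOdd B e f y) = 4 * B x y := by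
  simp only [oddForm_apply, toOdd_apply, map_add, map_smul, LinearMap.add_apply,
    LinearMap.smul_apply, smul_eq_mul, h.left, h.right, h.apply, (hB f e).trans h.apply, hB x e,
    hB x f]
  ring

/-- Every unit family of the odd form yields an orthogonal family for the original one. -/
theorem HyperbolicPair.exists_eq_four_mul (h : HyperbolicPair B e f)
    (hB : ∀ x y, B x y = B y x) : ∃ k : M → M, ∀ x y, B (k x) (k y) = 4 * oddForm B e f x y := by
  refine ⟨fun x => (2 : ℤ) • x + (2 * B e x) • e + (B f x - 3 * B e x) • f, fun x y => ?_⟩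
  simp only [oddForm_apply, map_add, map_smul, LinearMap.add_apply, LinearMap.smul_apply,
    smul_eq_mul, h.left, h.right, h.apply, (hB f e).trans h.apply, hB x e, hB x f]
  ring

theorem HyperbolicPair.injective_toOdd (h : HyperbolicPair B e f) (hB : ∀ x y, B x y = B y x)
    (hU : Unimodular B) : Function.Injective (toOdd B e f) := by
  rw [injective_iff_map_eq_zero]
  refine fun x hx => hU.1 x (LinearMap.ext fun y => ?_)
  have h1 := h.oddForm_toOdd hB x y
  rw [hx, map_zero, LinearMap.zero_apply] at h1
  rw [LinearMap.zero_apply]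
  omega

theorem HyperbolicPair.mem_range_toOdd (h : HyperbolicPair B e f) (hB : ∀ x y, B x y = B y x)
    (hE : ∀ x, Even (B x x)) {y : M} : y ∈ LinearMap.range (toOdd B e f) ↔
      ∃ (a : ℤ) (x : M), Even (oddForm B e f x x) ∧ y = a • (e + f) + (2 : ℤ) • x := by
  have hfe := (hB f e).trans h.apply
  constructor
  · rintro ⟨x, rfl⟩
    refine ⟨B f x, x - B f x • e - B e x • f + B e x • (e - f), ?_, ?_⟩
    · obtain ⟨k, hk⟩ := hE x
      refine ⟨k - B f x * B e x, ?_⟩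
      simp only [oddForm_apply, map_add, map_sub, map_smul, LinearMap.add_apply,
        LinearMap.sub_apply, LinearMap.smul_apply, smul_eq_mul, h.left, h.right, h.apply, hfe,
        hB x e, hB x f, hk]
      ring
    · rw [toOdd_apply]
      module
  · rintro ⟨a, x, hx, rfl⟩
    obtain ⟨c, hc⟩ : Even (B f x - B e x) := by
      have hx' := hx
      rw [oddForm_apply] at hx'
      have := hE x
      simp only [Int.even_add, Int.even_sub, Int.even_mul] at hx' this ⊢
      tauto
    refine ⟨x - B f x • e - B e x • f + (a + B f x + B e x) • e + c • f, ?_⟩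
    have h1 : B e (x - B f x • e - B e x • f + (a + B f x + B e x) • e + c • f) = c := by
      simp [h.left, h.apply]
    have h2 : B f (x - B f x • e - B e x • f + (a + B f x + B e x) • e + c • f) =
        a + B f x + B e x := by
      simp [h.right, hfe]
    rw [toOdd_apply, h1, h2]
    have h3 : B f x = B e x + (c + c) := by omega
    rw [h3]
    module

end OddForm

section EvenFromOdd

variable {M M' : Type*} [AddCommGroup M] [AddCommGroup M'] {B : LinearMap.BilinForm ℤ M}
  {B' : LinearMap.BilinForm ℤ M'} {e f : M} {e' f' : M'}

theorem HyperbolicPair.oddForm_add (h : HyperbolicPair B e f) (hB : ∀ x y, B x y = B y x) (x : M) :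
    oddForm B e f (e + f) x = B f x - B e x := by
  simp only [oddForm_apply, map_add, LinearMap.add_apply, h.left, h.right, h.apply,
    (hB f e).trans h.apply]
  ring

/-- The vector `e + f` is characteristic for the odd form. -/
theorem HyperbolicPair.even_oddForm_sub (h : HyperbolicPair B e f) (hB : ∀ x y, B x y = B y x)
    (hE : ∀ x, Even (B x x)) (x : M) : Even (oddForm B e f x x - oddForm B e f (e + f) x) := by
  rw [h.oddForm_add hB, oddForm_apply]
  have := hE x
  simp only [Int.even_add, Int.even_sub, Int.even_mul] at this ⊢
  tauto

/-- An isometry of the odd form, the reflection in the vector `f` of norm `-1`. -/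
theorem HyperbolicPair.exists_reflection (h : HyperbolicPair B e f) (hB : ∀ x y, B x y = B y x) :
    ∃ ρ : M ≃ₗ[ℤ] M, (∀ x, ρ x = x - (2 * B e x) • f) ∧
      ∀ x y, oddForm B e f (ρ x) (ρ y) = oddForm B e f x y := by
  refine ⟨LinearEquiv.ofInvolutive (LinearMap.id - ((2 : ℤ) • B e).smulRight f) fun x => ?_,
    fun x => rfl, fun x y => ?_⟩
  · change x - (2 * B e x) • f - (2 * B e (x - (2 * B e x) • f)) • f = x
    rw [map_sub, map_smul, h.apply, smul_eq_mul]
    module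
  · change oddForm B e f (x - (2 * B e x) • f) (y - (2 * B e y) • f) = _
    simp only [oddForm_apply, map_sub, map_smul, LinearMap.sub_apply, LinearMap.smul_apply,
      smul_eq_mul, h.right, h.apply, hB x f]
    ring

theorem HyperbolicPair.exists_even_oddIsometry (h : HyperbolicPair B e f)
    (h' : HyperbolicPair B' e' f') (hB : ∀ x y, B x y = B y x) (hB' : ∀ x y, B' x y = B' y x)
    (hE : ∀ x, Even (B x x)) (hE' : ∀ x, Even (B' x x)) (hU' : Unimodular B')
    (hθ : ∃ θ : M ≃ₗ[ℤ] M', ∀ x y, oddForm B' e' f' (θ x) (θ y) = oddForm B e f x y) :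
    ∃ (θ : M ≃ₗ[ℤ] M') (w : M'), (∀ x y, oddForm B' e' f' (θ x) (θ y) = oddForm B e f x y) ∧
      θ (e + f) = e' + f' + (2 : ℤ) • w ∧ Even (oddForm B' e' f' w w) := by
  obtain ⟨θ, hθ⟩ := hθ
  have hfe' := (hB' f' e').trans h'.apply
  obtain ⟨w, hw⟩ := (h'.unimodular_oddForm hB' hU').nondegMod Nat.prime_two
    (θ (e + f) - (e' + f')) fun y => by
      have h1 := h.even_oddForm_sub hB hE (θ.symm y)
      have h2 := h'.even_oddForm_sub hB' hE' y
      rw [← hθ, ← hθ, θ.apply_symm_apply] at h1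
      obtain ⟨k, hk⟩ := (h2.sub h1).two_dvd
      refine ⟨k, ?_⟩
      rw [map_sub, LinearMap.sub_apply, Nat.cast_ofNat, ← hk]
      ring
  have hw' : θ (e + f) = e' + f' + (2 : ℤ) • w := by
    rw [← sub_eq_iff_eq_add', hw]
    rfl
  by_cases hev : Even (oddForm B' e' f' w w)
  · exact ⟨θ, w, hθ, hw', hev⟩
  obtain ⟨ρ, hρ, hρB⟩ := h'.exists_reflection hB'
  refine ⟨θ.trans ρ, ρ w - f', fun x y => ?_, ?_, ?_⟩
  · rw [LinearEquiv.trans_apply, LinearEquiv.trans_apply, hρB, hθ]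
  · rw [LinearEquiv.trans_apply, hw', map_add, map_smul, hρ (e' + f'), map_add, h'.left, h'.apply]
    module
  · have h1 : oddForm B' e' f' (ρ w - f') (ρ w - f') =
        oddForm B' e' f' w w - 1 + 2 * (- oddForm B' e' f' (ρ w) f') := by
      have : oddForm B' e' f' f' f' = -1 := by
        simp [oddForm_apply, h'.right, h'.apply]
      rw [← hρB w w]
      simp only [map_sub, LinearMap.sub_apply, oddForm_comm hB' f', this]
      ring
    rw [h1]
    exact ((Int.not_even_iff_odd.mp hev).sub_odd odd_one).add (even_two_mul _)

theorem HyperbolicPair.map_range_le (h : HyperbolicPair B e f)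
    (h' : HyperbolicPair B' e' f') (hB : ∀ x y, B x y = B y x) (hB' : ∀ x y, B' x y = B' y x)
    (hE : ∀ x, Even (B x x)) (hE' : ∀ x, Even (B' x x)) {θ : M ≃ₗ[ℤ] M'} {w : M'}
    (hθ : ∀ x y, oddForm B' e' f' (θ x) (θ y) = oddForm B e f x y)
    (hw : θ (e + f) = e' + f' + (2 : ℤ) • w) (hw2 : Even (oddForm B' e' f' w w))
    {x : M} (hx : x ∈ LinearMap.range (toOdd B e f)) :
    θ x ∈ LinearMap.range (toOdd B' e' f') := by
  rw [h.mem_range_toOdd hB hE] at hx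
  rw [h'.mem_range_toOdd hB' hE']
  obtain ⟨a, z, hz, rfl⟩ := hx
  refine ⟨a, a • w + θ z, ?_, ?_⟩
  · rw [← hθ] at hz
    have : oddForm B' e' f' (a • w + θ z) (a • w + θ z) = a ^ 2 * oddForm B' e' f' w w +
        oddForm B' e' f' (θ z) (θ z) + 2 * (a * oddForm B' e' f' w (θ z)) := by
      simp only [map_add, map_smul, LinearMap.add_apply, LinearMap.smul_apply, smul_eq_mul,
        oddForm_comm hB' (θ z) w]
      ring
    rw [this]
    exact ((hw2.mul_left _).add hz).add (even_two_mul _)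
  · rw [map_add, map_smul, map_smul, hw]
    module

/-- Even unimodular lattices with hyperbolic pairs are isometric if the associated odd lattices
are. -/
theorem HyperbolicPair.exists_isometry (h : HyperbolicPair B e f)
    (h' : HyperbolicPair B' e' f') (hB : ∀ x y, B x y = B y x) (hB' : ∀ x y, B' x y = B' y x)
    (hE : ∀ x, Even (B x x)) (hE' : ∀ x, Even (B' x x)) (hU : Unimodular B) (hU' : Unimodular B')
    (hθ : ∃ θ : M ≃ₗ[ℤ] M', ∀ x y, oddForm B' e' f' (θ x) (θ y) = oddForm B e f x y) :
    ∃ σ : M ≃ₗ[ℤ] M', ∀ x y, B' (σ x) (σ y) = B x y := by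
  obtain ⟨θ, w, hθ, hw, hw2⟩ := h.exists_even_oddIsometry h' hB hB' hE hE' hU' hθ
  have hθ' : ∀ x y, oddForm B e f (θ.symm x) (θ.symm y) = oddForm B' e' f' x y := fun x y => by
    rw [← hθ, θ.apply_symm_apply, θ.apply_symm_apply]
  have hmap : (LinearMap.range (toOdd B e f)).map (θ : M →ₗ[ℤ] M') =
      LinearMap.range (toOdd B' e' f') := by
    refine le_antisymm ?_ fun y hy => ?_
    · rintro _ ⟨x, hx, rfl⟩
      exact h.map_range_le h' hB hB' hE hE' hθ hw hw2 hx
    · refine ⟨θ.symm y, h'.map_range_le h hB' hB hE' hE (w := - θ.symm w) hθ' ?_ ?_ hy,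
        θ.apply_symm_apply y⟩
      · rw [LinearEquiv.symm_apply_eq, map_add, hw, map_smul, map_neg, θ.apply_symm_apply]
        module
      · simpa [hθ'] using hw2
  let σ := (LinearEquiv.ofInjective _ (h.injective_toOdd hB hU)).trans
    ((θ.ofSubmodules _ _ hmap).trans (LinearEquiv.ofInjective _ (h'.injective_toOdd hB' hU')).symm)
  have hσ : ∀ x, toOdd B' e' f' (σ x) = θ (toOdd B e f x) := fun x =>
    congrArg Subtype.val (LinearEquiv.apply_symm_apply
      (LinearEquiv.ofInjective _ (h'.injective_toOdd hB' hU')) _)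
  refine ⟨σ, fun x y => ?_⟩
  have h1 := h'.oddForm_toOdd hB' (σ x) (σ y)
  rw [hσ, hσ, hθ, h.oddForm_toOdd hB] at h1
  omega

end EvenFromOdd

section EvenUnimodular

variable {M M' : Type*} [AddCommGroup M] [AddCommGroup M']
  {B' : LinearMap.BilinForm ℤ M'} {B : LinearMap.BilinForm ℤ M}

/-- Every orthogonal family of `r` anisotropic vectors contains exactly `k` of positive norm. -/
def HasPosIndex (B : LinearMap.BilinForm ℤ M) (r k : ℕ) : Prop :=
  ∀ w : Fin r → M, (∀ i j, i ≠ j → B (w i) (w j) = 0) → (∀ i, B (w i) (w i) ≠ 0) →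
    (Finset.univ.filter fun i => 0 < B (w i) (w i)).card = k

theorem UnitFamily.comp_equiv {ι κ : Type*} {v : ι → M} (hv : UnitFamily B v) (e : κ ≃ ι) :
    UnitFamily B (v ∘ e) :=
  ⟨fun _ _ hij => hv.orthogonal _ _ fun h => hij (e.injective h), fun i => hv.norm (e i),
    fun x hx => hv.complete x fun i => by simpa using hx (e.symm i)⟩

theorem UnitFamily.exists_isometry_of_card_eq {r k : ℕ} {v : Fin r → M} {v' : Fin r → M'}
    (hv : UnitFamily B v) (hv' : UnitFamily B' v')
    (hk : (Finset.univ.filter fun i => 0 < B (v i) (v i)).card = k)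
    (hk' : (Finset.univ.filter fun i => 0 < B' (v' i) (v' i)).card = k) :
    ∃ σ : M ≃ₗ[ℤ] M', ∀ x y, B' (σ x) (σ y) = B x y := by
  obtain ⟨π⟩ : Nonempty ({i // 0 < B (v i) (v i)} ≃ {i // 0 < B' (v' i) (v' i)}) := by
    rw [← Fintype.card_eq, Fintype.card_subtype, Fintype.card_subtype, hk, hk']
  refine hv.exists_isometry (hv'.comp_equiv π.extendSubtype) fun i => ?_
  rw [Function.comp_apply]
  by_cases hi : 0 < B (v i) (v i)
  · have h1 := π.extendSubtype_mem i hi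
    have h2 := hv.norm i
    have h3 := hv'.norm (π.extendSubtype i)
    omega
  · have h1 := π.extendSubtype_not_mem i hi
    have h2 := hv.norm i
    have h3 := hv'.norm (π.extendSubtype i)
    omega

theorem HyperbolicPair.exists_unitFamily_oddForm [Module.Free ℤ M] [Module.Finite ℤ M] {e f : M}
    (h : HyperbolicPair B e f) (hB : ∀ x y, B x y = B y x) (hU : Unimodular B) {r k : ℕ}
    (hr : Module.finrank ℤ M = r) (hk : HasPosIndex B r k) :
    ∃ v : Fin r → M, UnitFamily (oddForm B e f) v ∧
      (Finset.univ.filter fun i => 0 < oddForm B e f (v i) (v i)).card = k := by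
  have he : oddForm B e f e e = 1 := by
    simp [oddForm_apply, h.left, (hB f e).trans h.apply]
  have hf : oddForm B e f f f = -1 := by simp [oddForm_apply, h.right, h.apply]
  obtain ⟨v, hv⟩ := exists_unitFamily r (fun x y => oddForm_comm hB x y)
    (h.unimodular_oddForm hB hU) hr (fun _ => ⟨e, .inl he⟩)
    (fun _ => ⟨⟨e, by omega⟩, ⟨f, by omega⟩⟩)
  refine ⟨v, hv, ?_⟩
  obtain ⟨s, hs⟩ := h.exists_eq_four_mul hB
  rw [← hk (s ∘ v) (fun i j hij => ?_) fun i => ?_]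
  · congr 1
    ext i
    simp [hs]
  · simp [hs, hv.orthogonal i j hij]
  · have := hv.norm i
    simp only [Function.comp_apply, hs]
    omega

/-- Indefinite even unimodular lattices of the same rank and signature are isometric. -/
theorem Unimodular.exists_isometry_of_even [Module.Free ℤ M] [Module.Finite ℤ M]
    [Module.Free ℤ M'] [Module.Finite ℤ M'] (hU : Unimodular B) (hU' : Unimodular B')
    (hB : ∀ x y, B x y = B y x) (hB' : ∀ x y, B' x y = B' y x)
    (hE : ∀ x, Even (B x x)) (hE' : ∀ x, Even (B' x x)) {r k : ℕ} (h3 : 3 ≤ r)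
    (hr : Module.finrank ℤ M = r) (hr' : Module.finrank ℤ M' = r)
    (hpos : ∃ x, 0 < B x x) (hneg : ∃ x, B x x < 0)
    (hpos' : ∃ x, 0 < B' x x) (hneg' : ∃ x, B' x x < 0)
    (hk : HasPosIndex B r k) (hk' : HasPosIndex B' r k) :
    ∃ σ : M ≃ₗ[ℤ] M', ∀ x y, B' (σ x) (σ y) = B x y := by
  obtain ⟨x, hx, hx0⟩ := exists_isotropic hB (hr ▸ h3) (fun p hp _ => hU.nondegMod hp) hpos hneg
  obtain ⟨e, f, h⟩ := hU.exists_hyperbolicPair hB hE hx hx0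
  obtain ⟨x', hx', hx0'⟩ := exists_isotropic hB' (hr' ▸ h3) (fun p hp _ => hU'.nondegMod hp)
    hpos' hneg'
  obtain ⟨e', f', h'⟩ := hU'.exists_hyperbolicPair hB' hE' hx' hx0'
  obtain ⟨v, hv, hvk⟩ := h.exists_unitFamily_oddForm hB hU hr hk
  obtain ⟨v', hv', hvk'⟩ := h'.exists_unitFamily_oddForm hB' hU' hr' hk'
  exact h.exists_isometry h' hB hB' hE hE' hU hU' (hv.exists_isometry_of_card_eq hv' hvk hvk')

end EvenUnimodular

section NearlyUnimodular

variable {M : Type*} [AddCommGroup M] {B : LinearMap.BilinForm ℤ M} {u : M →ₗ[ℤ] ℤ} {v : M}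

theorem HasPosIndex.exists_pos_and_neg [Module.Free ℤ M] [Module.Finite ℤ M] {r k : ℕ}
    (hk : HasPosIndex B r k) (hB : ∀ x y, B x y = B y x) (h3 : NondegMod 3 B)
    (hr : Module.finrank ℤ M = r) (h0 : 0 < k) (hkr : k < r) :
    (∃ x, 0 < B x x) ∧ ∃ x, B x x < 0 := by
  obtain ⟨w, hw, hw3⟩ := exists_orthogonal_family Nat.prime_three (by norm_num) r hB h3 hr
  have hw0 : ∀ i, B (w i) (w i) ≠ 0 := fun i h => hw3 i (h ▸ dvd_zero _)
  have hc := hk w hw hw0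
  constructor
  · obtain ⟨i, hi⟩ := Finset.card_pos.mp (hc ▸ h0)
    exact ⟨w i, (Finset.mem_filter.mp hi).2⟩
  · by_contra! h
    rw [Finset.filter_true_of_mem fun i _ => lt_of_le_of_ne (h _) (hw0 i).symm] at hc
    simp at hc
    omega

/-- A lattice whose discriminant group has order two, generated by half of the vector `v`, the
value of the discriminant form at the generator being `1 / 2`. -/
structure NearlyUnimodular (B : LinearMap.BilinForm ℤ M) (u : M →ₗ[ℤ] ℤ) (v : M) : Prop where
  nondeg : ∀ x, B x = 0 → x = 0
  double : B v = (2 : ℤ) • u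
  norm : ∃ t, B v v = 2 + 8 * t
  surj : ∀ g : M →ₗ[ℤ] ℤ, ∃ x, g = B x ∨ g = u + B x

theorem NearlyUnimodular.apply (h : NearlyUnimodular B u v) (x : M) : B v x = 2 * u x := by
  rw [h.double]
  rfl

theorem NearlyUnimodular.nondegMod (h : NearlyUnimodular B u v) {p : ℕ} (hp : p.Prime)
    (hp2 : p ≠ 2) : NondegMod p B := by
  intro x hx
  obtain ⟨g, hg⟩ := exists_eq_smul_of_dvd (by exact_mod_cast hp.ne_zero) hx
  obtain ⟨z, rfl | rfl⟩ := h.surj g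
  · exact ⟨z, sub_eq_zero.mp (h.nondeg _ (by rw [map_sub, hg, map_smul, sub_self]))⟩
  · obtain ⟨m, hm⟩ := hp.odd_of_ne_two hp2
    have h1 : (2 : ℤ) • x = (p : ℤ) • (v + (2 : ℤ) • z) := by
      refine sub_eq_zero.mp (h.nondeg _ ?_)
      rw [map_sub, map_smul, map_smul, map_add, map_smul, hg, h.double]
      module
    refine ⟨x - (m : ℤ) • (v + (2 : ℤ) • z), ?_⟩
    have h2 : (p : ℤ) = 2 * m + 1 := by exact_mod_cast hm
    calc x = (p : ℤ) • x - (m : ℤ) • ((2 : ℤ) • x) := by rw [h2]; module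
      _ = _ := by rw [h1]; module

theorem NearlyUnimodular.exists_hyperbolic (h : NearlyUnimodular B u v)
    (hB : ∀ x y, B x y = B y x) (hE : ∀ x, Even (B x x)) {x : M} (hx : x ≠ 0) (h0 : B x x = 0) :
    ∃ e f, B e e = 0 ∧ B e f = 1 := by
  obtain ⟨d, g, y, hd, hg, hy⟩ := exists_eq_smul_surjective fun hh => hx (h.nondeg x hh)
  obtain ⟨z, rfl | rfl⟩ := h.surj g
  · have hxe : x = d • z := sub_eq_zero.mp (h.nondeg _ (by rw [map_sub, hg, map_smul, sub_self]))
    refine ⟨z, y, ?_, hy⟩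
    rw [hxe] at h0
    simpa [hd] using h0
  · have h1 : (2 : ℤ) • x = d • (v + (2 : ℤ) • z) := by
      refine sub_eq_zero.mp (h.nondeg _ ?_)
      rw [map_sub, map_smul, map_smul, map_add, map_smul, hg, h.double]
      module
    have h2 : B ((2 : ℤ) • x) ((2 : ℤ) • x) = 0 := by simp [h0]
    rw [h1] at h2
    simp only [map_smul, LinearMap.smul_apply, smul_eq_mul, mul_eq_zero, hd, false_or] at h2
    obtain ⟨t, ht⟩ := h.norm
    obtain ⟨s, hs⟩ := hE z
    simp only [map_add, map_smul, LinearMap.add_apply, LinearMap.smul_apply, smul_eq_mul,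
      hB z v, h.apply z, ht, hs] at h2
    omega

theorem NearlyUnimodular.add (h : NearlyUnimodular B u v) (hB : ∀ x y, B x y = B y x)
    (hE : ∀ x, Even (B x x)) (x : M) : NearlyUnimodular B (u + B x) (v + (2 : ℤ) • x) := by
  refine ⟨h.nondeg, ?_, ?_, fun g => ?_⟩
  · rw [map_add, map_smul, h.double, smul_add]
  · obtain ⟨t, ht⟩ := h.norm
    obtain ⟨s, hs⟩ := hE x
    refine ⟨t + u x + s, ?_⟩
    simp only [map_add, map_smul, LinearMap.add_apply, LinearMap.smul_apply, smul_eq_mul,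
      hB x v, h.apply x, ht, hs]
    ring
  · obtain ⟨z, rfl | rfl⟩ := h.surj g
    · exact ⟨z, .inl rfl⟩
    · exact ⟨z - x, .inr (by rw [map_sub]; abel)⟩

theorem NearlyUnimodular.exists_norm_two (h : NearlyUnimodular B u v) (hB : ∀ x y, B x y = B y x)
    (hE : ∀ x, Even (B x x)) {e f : M} (he : B e e = 0) (hef : B e f = 1) :
    ∃ u' v', NearlyUnimodular B u' v' ∧ B v' v' = 2 := by
  have h1 := h.add hB hE ((1 - u e) • f)
  have h1e : (u + B ((1 - u e) • f)) e = 1 := by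
    simp [hB f e, hef]
  obtain ⟨t, ht⟩ := h1.norm
  refine ⟨_, _, h1.add hB hE (-t • e), ?_⟩
  generalize v + (2 : ℤ) • (1 - u e) • f = v₁ at *
  generalize u + B ((1 - u e) • f) = u₁ at *
  have h2 : B v₁ e = 2 := by rw [h1.apply, h1e]; rfl
  simp only [map_add, map_smul, LinearMap.add_apply, LinearMap.smul_apply, smul_eq_mul,
    hB e v₁, h2, ht, he]
  ring

theorem NearlyUnimodular.apply_self (h : NearlyUnimodular B u v) (h2 : B v v = 2) : u v = 1 := by
  have := h.apply v
  omega

theorem NearlyUnimodular.sub_mem_ker (h : NearlyUnimodular B u v) (h2 : B v v = 2) (x : M) :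
    x - u x • v ∈ LinearMap.ker u := by
  rw [LinearMap.mem_ker, map_sub, map_smul, h.apply_self h2, smul_eq_mul, mul_one, sub_self]

theorem NearlyUnimodular.unimodular_ker (h : NearlyUnimodular B u v) (hB : ∀ x y, B x y = B y x)
    (h2 : B v v = 2) : Unimodular (B.restrict (LinearMap.ker u)) := by
  refine ⟨fun x hx => Subtype.ext (h.nondeg _ (LinearMap.ext fun y => ?_)), fun f => ?_⟩
  · have h1 : B x (y - u y • v) = 0 := LinearMap.congr_fun hx ⟨_, h.sub_mem_ker h2 y⟩
    have h3 : u x = 0 := x.2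
    rw [map_sub, map_smul, hB x v, h.apply, h3, mul_zero, smul_zero, sub_zero] at h1
    exact h1
  · let g : M →ₗ[ℤ] ℤ := f ∘ₗ
      (LinearMap.id - u.smulRight v).codRestrict (LinearMap.ker u) (h.sub_mem_ker h2)
    have hg : ∀ x : LinearMap.ker u, g x = f x := by
      intro x
      have h3 : u x = 0 := x.2
      refine congrArg f (Subtype.ext ?_)
      change (x : M) - u x • v = x
      rw [h3, zero_smul, sub_zero]
    obtain ⟨z, hz⟩ : ∃ z, ∀ y : LinearMap.ker u, B z y = f y := by
      obtain ⟨z, hz | hz⟩ := h.surj g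
      · exact ⟨z, fun y => by rw [← hg, hz]⟩
      · refine ⟨z, fun y => ?_⟩
        have h3 : u y = 0 := y.2
        rw [← hg, hz, LinearMap.add_apply, h3, zero_add]
    refine ⟨⟨_, h.sub_mem_ker h2 z⟩, LinearMap.ext fun y => ?_⟩
    have h3 : u y = 0 := y.2
    change B (z - u z • v) y = f y
    rw [map_sub, map_smul, LinearMap.sub_apply, LinearMap.smul_apply, h.apply, h3, mul_zero,
      smul_zero, sub_zero, hz]

theorem NearlyUnimodular.finrank_ker [Module.Free ℤ M] [Module.Finite ℤ M]
    (h : NearlyUnimodular B u v) (h2 : B v v = 2) {r : ℕ} (hr : Module.finrank ℤ M = r + 1) :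
    Module.finrank ℤ (LinearMap.ker u) = r := by
  have hu : u ≠ 0 := by
    intro h0
    have := h.apply_self h2
    simp [h0] at this
  exact Nat.succ.inj ((finrank_ker_add_one hu).trans hr)

theorem NearlyUnimodular.hasPosIndex_ker (h : NearlyUnimodular B u v)
    (hB : ∀ x y, B x y = B y x) (h2 : B v v = 2) {r k : ℕ} (hk : HasPosIndex B (r + 1) (k + 1)) :
    HasPosIndex (B.restrict (LinearMap.ker u)) r k := by
  intro w hw hw0
  have hv : ∀ i, B v (w i) = 0 := fun i => by
    have h3 : u (w i) = 0 := (w i).2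
    rw [h.apply, h3, mul_zero]
  have h1 := hk (Fin.cons v fun i => (w i : M)) (fun i j => ?_) fun i => ?_
  · rw [Fin.card_filter_univ_succ, if_pos (by simp [h2])] at h1
    exact Nat.succ.inj h1
  · refine Fin.cases ?_ (fun i => ?_) i <;> refine Fin.cases ?_ (fun j => ?_) j
    · exact fun hh => absurd rfl hh
    · exact fun _ => hv j
    · exact fun _ => (hB _ _).trans (hv i)
    · exact fun hh => hw i j fun e => hh (congrArg Fin.succ e)
  · refine Fin.cases ?_ (fun i => hw0 i) i
    rw [Fin.cons_zero, h2]
    exact two_ne_zero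

/-- An isometry of the orthogonal complements extends to the lattices. -/
theorem NearlyUnimodular.exists_isometry_of_ker {M' : Type*} [AddCommGroup M']
    {B' : LinearMap.BilinForm ℤ M'} {u' : M' →ₗ[ℤ] ℤ} {v' : M'} (h : NearlyUnimodular B u v)
    (h' : NearlyUnimodular B' u' v') (hB : ∀ x y, B x y = B y x) (hB' : ∀ x y, B' x y = B' y x)
    (h2 : B v v = 2) (h2' : B' v' v' = 2)
    (hσ : ∃ σ : LinearMap.ker u ≃ₗ[ℤ] LinearMap.ker u',
      ∀ x y, B'.restrict (LinearMap.ker u') (σ x) (σ y) = B.restrict (LinearMap.ker u) x y) :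
    ∃ τ : M ≃ₗ[ℤ] M', ∀ x y, B' (τ x) (τ y) = B x y := by
  obtain ⟨σ, hσ⟩ := hσ
  let τ : M →ₗ[ℤ] M' := u.smulRight v' + (LinearMap.ker u').subtype ∘ₗ σ.toLinearMap ∘ₗ
    (LinearMap.id - u.smulRight v).codRestrict (LinearMap.ker u) (h.sub_mem_ker h2)
  have hτ : ∀ x, τ x = u x • v' + (σ ⟨_, h.sub_mem_ker h2 x⟩ : M') := fun x => rfl
  have hiso : ∀ x y, B' (τ x) (τ y) = B x y := by
    intro x y
    have hz : ∀ z : LinearMap.ker u', B' v' z = 0 := fun z => by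
      have h3 : u' z = 0 := z.2
      rw [h'.apply, h3, mul_zero]
    have h3 : B' (σ ⟨_, h.sub_mem_ker h2 x⟩) (σ ⟨_, h.sub_mem_ker h2 y⟩) =
      B (x - u x • v) (y - u y • v) := hσ _ _
    rw [hτ, hτ]
    simp only [map_add, map_smul, LinearMap.add_apply, LinearMap.smul_apply, smul_eq_mul, h3, hz,
      hB' _ v', h2']
    simp only [map_sub, map_smul, LinearMap.sub_apply, LinearMap.smul_apply, smul_eq_mul, h2,
      hB x v, h.apply]
    ring
  refine ⟨LinearEquiv.ofBijective τ ⟨?_, fun y => ?_⟩, hiso⟩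
  · rw [injective_iff_map_eq_zero]
    refine fun x hx => h.nondeg x (LinearMap.ext fun y => ?_)
    rw [← hiso, hx, map_zero, LinearMap.zero_apply, LinearMap.zero_apply]
  · let z := σ.symm ⟨_, h'.sub_mem_ker h2' y⟩
    have hz : u z = 0 := z.2
    have hx : u (u' y • v + z) = u' y := by
      rw [map_add, map_smul, h.apply_self h2, hz, smul_eq_mul, mul_one, add_zero]
    refine ⟨u' y • v + z, ?_⟩
    have h3 : (⟨_, h.sub_mem_ker h2 (u' y • v + z)⟩ : LinearMap.ker u) = z := by
      refine Subtype.ext ?_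
      change u' y • v + z - u (u' y • v + z) • v = z
      rw [hx, add_sub_cancel_left]
    rw [hτ, h3, hx, σ.apply_symm_apply, add_sub_cancel]

theorem NearlyUnimodular.exists_split [Module.Free ℤ M] [Module.Finite ℤ M]
    (h : NearlyUnimodular B u v) (hB : ∀ x y, B x y = B y x) (hE : ∀ x, Even (B x x)) {r k : ℕ}
    (hr : Module.finrank ℤ M = r + 1) (hk : HasPosIndex B (r + 1) (k + 1)) (h3 : 3 ≤ r)
    (hkr : k < r) : ∃ u' v', NearlyUnimodular B u' v' ∧ B v' v' = 2 := by
  have hN := fun p hp hp2 => h.nondegMod (p := p) hp hp2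
  obtain ⟨hpos, hneg⟩ := hk.exists_pos_and_neg hB (hN 3 Nat.prime_three (by norm_num)) hr
    k.succ_pos (Nat.succ_lt_succ hkr)
  obtain ⟨x, hx, hx0⟩ := exists_isotropic hB (by omega) hN hpos hneg
  obtain ⟨e, f, he, hef⟩ := h.exists_hyperbolic hB hE hx hx0
  exact h.exists_norm_two hB hE he hef

/-- Indefinite even lattices whose discriminant form is that of `⟨2⟩` are determined by rank and
signature. -/
theorem NearlyUnimodular.exists_isometry {M' : Type*} [AddCommGroup M'] [Module.Free ℤ M]
    [Module.Finite ℤ M] [Module.Free ℤ M'] [Module.Finite ℤ M']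
    {B' : LinearMap.BilinForm ℤ M'} {u' : M' →ₗ[ℤ] ℤ} {v' : M'} (h : NearlyUnimodular B u v)
    (h' : NearlyUnimodular B' u' v') (hB : ∀ x y, B x y = B y x) (hB' : ∀ x y, B' x y = B' y x)
    (hE : ∀ x, Even (B x x)) (hE' : ∀ x, Even (B' x x)) {r k : ℕ}
    (hr : Module.finrank ℤ M = r + 1) (hr' : Module.finrank ℤ M' = r + 1)
    (hk : HasPosIndex B (r + 1) (k + 1)) (hk' : HasPosIndex B' (r + 1) (k + 1)) (h3 : 3 ≤ r)
    (h0 : 0 < k) (hkr : k < r) : ∃ τ : M ≃ₗ[ℤ] M', ∀ x y, B' (τ x) (τ y) = B x y := by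
  obtain ⟨u₁, v₁, h₁, h2⟩ := h.exists_split hB hE hr hk h3 hkr
  obtain ⟨u₁', v₁', h₁', h2'⟩ := h'.exists_split hB' hE' hr' hk' h3 hkr
  refine h₁.exists_isometry_of_ker h₁' hB hB' h2 h2' ?_
  have hU := h₁.unimodular_ker hB h2
  have hU' := h₁'.unimodular_ker hB' h2'
  have hr₁ := h₁.finrank_ker h2 hr
  have hr₁' := h₁'.finrank_ker h2' hr'
  have hk₁ := h₁.hasPosIndex_ker hB h2 hk
  have hk₁' := h₁'.hasPosIndex_ker hB' h2' hk'
  have hB₁ : ∀ x y, B.restrict (LinearMap.ker u₁) x y = B.restrict (LinearMap.ker u₁) y x :=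
    fun x y => hB x y
  have hB₁' : ∀ x y, B'.restrict (LinearMap.ker u₁') x y = B'.restrict (LinearMap.ker u₁') y x :=
    fun x y => hB' x y
  obtain ⟨hpos, hneg⟩ := hk₁.exists_pos_and_neg hB₁ (hU.nondegMod Nat.prime_three) hr₁ h0 hkr
  obtain ⟨hpos', hneg'⟩ := hk₁'.exists_pos_and_neg hB₁' (hU'.nondegMod Nat.prime_three) hr₁' h0 hkr
  exact hU.exists_isometry_of_even hU' hB₁ hB₁' (fun x => hE x) (fun x => hE' x) h3 hr₁ hr₁' hpos
    hneg hpos' hneg' hk₁ hk₁'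

end NearlyUnimodular

section GramMatrices

theorem dsum_mulVec {m k : ℕ} (A : Matrix (Fin m) (Fin m) ℤ) (B : Matrix (Fin k) (Fin k) ℤ)
    (x : Fin m → ℤ) (y : Fin k → ℤ) :
    dsum A B *ᵥ Fin.append x y = Fin.append (A *ᵥ x) (B *ᵥ y) := by
  have h : Fin.append x y ∘ finSumFinEquiv.symm.symm = Sum.elim x y := by
    ext (i | i) <;> simp
  rw [dsum, reindex_apply, submatrix_mulVec_equiv, h, fromBlocks_mulVec]
  ext i
  refine Fin.addCases (fun i => ?_) (fun i => ?_) i <;> simp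

theorem append_dotProduct {m k : ℕ} (x x' : Fin m → ℤ) (y y' : Fin k → ℤ) :
    Fin.append x y ⬝ᵥ Fin.append x' y' = x ⬝ᵥ x' + y ⬝ᵥ y' := by
  simp [dotProduct, Fin.sum_univ_add]

theorem hasSignature_of_diagonal {n p q : ℕ} {A W : Matrix (Fin n) (Fin n) ℤ} {c : Fin n → ℤ}
    (h : Wᵀ * A * W = diagonal c) (hc : ∀ i, c i ≠ 0)
    (hp : (Finset.univ.filter fun i => 0 < c i).card = p)
    (hq : (Finset.univ.filter fun i => c i < 0).card = q) : HasSignature A p q := by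
  have h' : (W.map (Int.castRingHom ℝ))ᵀ * A.map (Int.castRingHom ℝ) *
      W.map (Int.castRingHom ℝ) = diagonal fun i => (c i : ℝ) := by
    have := congrArg (fun X => X.map (Int.castRingHom ℝ)) h
    simp only [Matrix.map_mul] at this
    rw [← transpose_map, this, diagonal_map (map_zero _)]
    rfl
  let s : Fin n → ℝ := fun i => (√|(c i : ℝ)|)⁻¹
  have hs : ∀ i, s i * c i * s i = if 0 < c i then 1 else -1 := by
    intro i
    have h0 : 0 < |(c i : ℝ)| := abs_pos.mpr (by exact_mod_cast hc i)
    have h1 : √|(c i : ℝ)| * √|(c i : ℝ)| = |(c i : ℝ)| := Real.mul_self_sqrt h0.le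
    have h2 : s i * c i * s i = c i / |(c i : ℝ)| := by
      rw [← h1]
      have := (Real.sqrt_pos.mpr h0).ne'
      simp only [s]
      field_simp
    rw [h2]
    split_ifs with hi
    · have : (0 : ℝ) < c i := by exact_mod_cast hi
      rw [abs_of_pos this, div_self this.ne']
    · have : (c i : ℝ) < 0 := by exact_mod_cast lt_of_le_of_ne (not_lt.mp hi) (hc i)
      rw [abs_of_neg this, div_neg, div_self this.ne]
  have hP : (W.map (Int.castRingHom ℝ) * diagonal s)ᵀ * A.map (Int.cast : ℤ → ℝ) *
      (W.map (Int.castRingHom ℝ) * diagonal s) =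
      diagonal fun i => if 0 < c i then (1 : ℝ) else -1 := by
    calc _ = diagonal s * ((W.map (Int.castRingHom ℝ))ᵀ * A.map (Int.castRingHom ℝ) *
          W.map (Int.castRingHom ℝ)) * diagonal s := by
          rw [transpose_mul, diagonal_transpose]
          simp only [Matrix.mul_assoc]
          rfl
      _ = _ := by
          rw [h', diagonal_mul_diagonal, diagonal_mul_diagonal]
          simp only [hs]
  refine ⟨_, _, isUnit_det_of_congruent (fun i => ?_) hP, fun i => ?_, ?_, ?_, hP⟩
  · split_ifs <;> norm_num
  · split_ifs <;> simp
  · rw [← hp]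
    congr 1
    ext i
    simp only [Finset.mem_filter, Finset.mem_univ, true_and]
    split_ifs with hi <;> norm_num [hi]
  · rw [← hq]
    congr 1
    ext i
    have := hc i
    simp only [Finset.mem_filter, Finset.mem_univ, true_and]
    split_ifs with hi
    · norm_num
      omega
    · norm_num
      omega

theorem HasSignature.dsum {m k p q p' q' : ℕ} {A : Matrix (Fin m) (Fin m) ℤ}
    {B : Matrix (Fin k) (Fin k) ℤ} (hA : HasSignature A p q) (hB : HasSignature B p' q') :
    HasSignature (dsum A B) (p + p') (q + q') := by
  obtain ⟨P, d, hP, hd, hp, hq, h⟩ := hA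
  obtain ⟨P', d', hP', hd', hp', hq', h'⟩ := hB
  refine ⟨(fromBlocks P 0 0 P').submatrix finSumFinEquiv.symm finSumFinEquiv.symm,
    Fin.append d d', ?_, fun i => ?_, ?_, ?_, ?_⟩
  · rw [det_submatrix_equiv_self, det_fromBlocks_zero₂₁]
    exact hP.mul hP'
  · refine Fin.addCases (fun i => ?_) (fun i => ?_) i
    · simpa using hd i
    · simpa using hd' i
  · rw [← hp, ← hp']
    simp only [Finset.card_filter, Fin.sum_univ_add, Fin.append_left, Fin.append_right]
  · rw [← hq, ← hq']
    simp only [Finset.card_filter, Fin.sum_univ_add, Fin.append_left, Fin.append_right]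
  · rw [_root_.dsum, reindex_apply, transpose_submatrix, ← submatrix_map, submatrix_mul_equiv,
      submatrix_mul_equiv, fromBlocks_transpose, fromBlocks_map, fromBlocks_multiply,
      fromBlocks_multiply]
    simp only [transpose_zero, Matrix.zero_mul, Matrix.mul_zero, add_zero, zero_add,
      Matrix.map_zero _ (Int.cast_zero), h, h', fromBlocks_diagonal]
    ext i j
    rw [submatrix_apply, diagonal_apply, diagonal_apply]
    simp only [EmbeddingLike.apply_eq_iff_eq]
    congr 1
    refine Fin.addCases (fun i => ?_) (fun i => ?_) i <;> simp

/-- The invariants of an even lattice that are read off an orthogonal decomposition. -/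
structure EvenGram {n : ℕ} (A : Matrix (Fin n) (Fin n) ℤ) (d p q : ℕ) : Prop where
  transpose : Aᵀ = A
  even : ∀ x, Even (x ⬝ᵥ A *ᵥ x)
  det : A.det.natAbs = d
  signature : HasSignature A p q

theorem EvenGram.dsum {m k d p q d' p' q' : ℕ} {A : Matrix (Fin m) (Fin m) ℤ}
    {B : Matrix (Fin k) (Fin k) ℤ} (hA : EvenGram A d p q) (hB : EvenGram B d' p' q') :
    EvenGram (dsum A B) (d * d') (p + p') (q + q') := by
  refine ⟨?_, fun x => ?_, ?_, hA.signature.dsum hB.signature⟩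
  · rw [_root_.dsum, transpose_reindex, fromBlocks_transpose, hA.transpose, hB.transpose,
      transpose_zero, transpose_zero]
  · rw [← Fin.append_castAdd_natAdd (f := x), dsum_mulVec, append_dotProduct]
    exact (hA.even _).add (hB.even _)
  · rw [_root_.dsum, reindex_apply, det_submatrix_equiv_self, det_fromBlocks_zero₂₁,
      Int.natAbs_mul, hA.det, hB.det]

theorem evenGram_two : EvenGram !![2] 2 1 0 := by
  refine ⟨by decide, fun x => ?_, by decide, hasSignature_of_diagonal (W := 1) (c := fun _ => 2)
    (by decide) (by decide) (by decide) (by decide)⟩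
  simp [dotProduct, mulVec]

theorem evenGram_UM : EvenGram UM 1 1 1 := by
  refine ⟨by decide, fun x => ⟨x 0 * x 1, ?_⟩, by simp [UM, det_fin_two],
    hasSignature_of_diagonal (W := !![1, 1; 1, -1]) (c := ![2, -2])
    (by decide) (by decide) (by decide) (by decide)⟩
  simp [dotProduct, mulVec, UM, Fin.sum_univ_two]
  ring

theorem evenGram_neg_E8M : EvenGram (-E8M) 1 0 8 := by
  refine ⟨by decide +kernel, fun x => ?_, ?_, hasSignature_of_diagonal
    (W := !![1, 0, 1, 2, 2, 2, 2, 2;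
             0, 1, 0, 3, 3, 3, 3, 3;
             0, 0, 2, 4, 4, 4, 4, 4;
             0, 0, 0, 6, 6, 6, 6, 6;
             0, 0, 0, 0, 5, 5, 5, 5;
             0, 0, 0, 0, 0, 4, 4, 4;
             0, 0, 0, 0, 0, 0, 3, 3;
             0, 0, 0, 0, 0, 0, 0, 2])
    (c := ![-2, -2, -6, -30, -20, -12, -6, -2])
    (by decide +kernel) (by decide) (by decide) (by decide)⟩
  · refine ⟨- (x 0 ^ 2 + x 1 ^ 2 + x 2 ^ 2 + x 3 ^ 2 + x 4 ^ 2 + x 5 ^ 2 + x 6 ^ 2 + x 7 ^ 2 -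
      x 0 * x 2 - x 1 * x 3 - x 2 * x 3 - x 3 * x 4 - x 4 * x 5 - x 5 * x 6 - x 6 * x 7), ?_⟩
    simp [dotProduct, mulVec, E8M, Fin.sum_univ_eight]
    ring
  · refine Int.natAbs_of_isUnit (IsUnit.of_mul_eq_one (Matrix.det
      (-!![4, 5, 7, 10, 8, 6, 4, 2;
           5, 8, 10, 15, 12, 9, 6, 3;
           7, 10, 14, 20, 16, 12, 8, 4;
           10, 15, 20, 30, 24, 18, 12, 6;
           8, 12, 16, 24, 20, 15, 10, 5;
           6, 9, 12, 18, 15, 12, 8, 4;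
           4, 6, 8, 12, 10, 8, 6, 3;
           2, 3, 4, 6, 5, 4, 3, 2])) ?_)
    rw [← det_mul, ← det_one (n := Fin 8) (R := ℤ)]
    congr 1
    decide +kernel

theorem evenGram_M43 : EvenGram M43 2 6 37 :=
  ((((((((evenGram_two.dsum evenGram_UM).dsum evenGram_UM).dsum evenGram_UM).dsum
    evenGram_UM).dsum evenGram_UM).dsum evenGram_neg_E8M).dsum evenGram_neg_E8M).dsum
    evenGram_neg_E8M).dsum evenGram_neg_E8M

theorem exists_dsum_mulVec {m k : ℕ} {A : Matrix (Fin m) (Fin m) ℤ} (B : Matrix (Fin k) (Fin k) ℤ)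
    (h : ∃ v u, A *ᵥ v = (2 : ℤ) • u ∧ v ⬝ᵥ u = 1) :
    ∃ v u, dsum A B *ᵥ v = (2 : ℤ) • u ∧ v ⬝ᵥ u = 1 := by
  obtain ⟨v, u, hv, hu⟩ := h
  refine ⟨Fin.append v 0, Fin.append u 0, ?_, ?_⟩
  · rw [dsum_mulVec, hv, mulVec_zero]
    ext i
    refine Fin.addCases (fun i => ?_) (fun i => ?_) i <;> simp
  · rw [append_dotProduct, hu, zero_dotProduct, add_zero]

theorem exists_two_mulVec : ∃ v u : Fin 1 → ℤ, !![2] *ᵥ v = (2 : ℤ) • u ∧ v ⬝ᵥ u = 1 :=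
  ⟨1, 1, by decide, by decide⟩

theorem exists_M43_mulVec : ∃ v u, M43 *ᵥ v = (2 : ℤ) • u ∧ v ⬝ᵥ u = 1 :=
  exists_dsum_mulVec (-E8M) <| exists_dsum_mulVec (-E8M) <| exists_dsum_mulVec (-E8M) <|
    exists_dsum_mulVec (-E8M) <| exists_dsum_mulVec UM <| exists_dsum_mulVec UM <|
    exists_dsum_mulVec UM <| exists_dsum_mulVec UM <| exists_dsum_mulVec UM exists_two_mulVec

end GramMatrices

section DiscriminantForm

theorem HasSignature.hasPosIndex {n p q : ℕ} {G : Matrix (Fin n) (Fin n) ℤ}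
    (h : HasSignature G p q) : HasPosIndex (Matrix.toBilin' G) n p := by
  intro w hw hw0
  obtain ⟨P, d, -, hd, hp, hq, hP⟩ := h
  obtain ⟨Q, hQ⟩ := exists_diagonalization ℝ (Pi.basisFun ℤ (Fin n)) hw
  rw [LinearMap.BilinForm.toMatrix_basisFun, LinearMap.BilinForm.toMatrix'_toBilin'] at hQ
  have hd0 : ∀ i, d i ≠ 0 := fun i => by rcases hd i with h | h <;> norm_num [h]
  have hw0' : ∀ i, (Matrix.toBilin' G (w i) (w i) : ℝ) ≠ 0 := fun i => by exact_mod_cast hw0 i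
  have hcard := (neutral_of_diagonalizations hd0 hP hQ).card_pos_eq_card_neg (by
    rintro (i | i)
    · exact hd0 i
    · exact neg_ne_zero.mpr (hw0' i))
  have hpos : ∀ i, 0 < d i ↔ d i = 1 := fun i => by rcases hd i with h | h <;> norm_num [h]
  have hneg : ∀ i, d i < 0 ↔ d i = -1 := fun i => by rcases hd i with h | h <;> norm_num [h]
  simp only [Finset.card_filter, Fintype.sum_sum_type, Sum.elim_inl, Sum.elim_inr, hpos, hneg,
    neg_pos, neg_lt_zero, Int.cast_pos, Int.cast_lt_zero] at hcard
  have h1 : ∑ i, (if d i = 1 then 1 else 0) + ∑ i, (if d i = -1 then 1 else 0) = n := by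
    rw [← Finset.sum_add_distrib]
    trans ∑ _i : Fin n, 1
    · refine Finset.sum_congr rfl fun i _ => ?_
      rcases hd i with h | h <;> norm_num [h]
    · simp
  have h2 : ∑ i, (if Matrix.toBilin' G (w i) (w i) < 0 then 1 else 0) +
      ∑ i, (if 0 < Matrix.toBilin' G (w i) (w i) then 1 else 0) = n := by
    rw [← Finset.sum_add_distrib]
    trans ∑ _i : Fin n, 1
    · refine Finset.sum_congr rfl fun i _ => ?_
      have := hw0 i
      split_ifs <;> omega
    · simp
  rw [← hp]
  simp only [Finset.card_filter]
  omega

theorem nat_card_discGroup {n : ℕ} {G : Matrix (Fin n) (Fin n) ℤ} (hG : G.det ≠ 0) :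
    Nat.card (DiscGroup G) = G.det.natAbs := by
  have hinj : Function.Injective G.mulVecLin := mulVec_injective_of_det_ne_zero hG
  have := Submodule.natAbs_det_equiv (LinearMap.range G.mulVecLin)
    (LinearEquiv.ofInjective G.mulVecLin hinj)
  rw [← LinearMap.det_toLin']
  exact this.symm

theorem discMk_eq_iff {n : ℕ} {G : Matrix (Fin n) (Fin n) ℤ} {x y : Fin n → ℤ} :
    discMk G x = discMk G y ↔ ∃ z, G *ᵥ z = x - y :=
  (Submodule.Quotient.eq _).trans Iff.rfl

theorem discQuad_eq {n : ℕ} {G : Matrix (Fin n) (Fin n) ℤ} (hG : G.det ≠ 0) {u v : Fin n → ℤ}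
    {m : ℤ} (hm : m ≠ 0) (h : G *ᵥ v = m • u) :
    discQuad G u = (((v ⬝ᵥ u : ℤ) / m : ℚ) : AddCircle (2 : ℚ)) := by
  have hdet : IsUnit (G.map (Int.cast : ℤ → ℚ)).det := by
    have : (G.map (Int.cast : ℤ → ℚ)).det = G.det := (RingHom.map_det (Int.castRingHom ℚ) G).symm
    rw [this]
    exact isUnit_iff_ne_zero.mpr (by exact_mod_cast hG)
  have h1 : G.map (Int.cast : ℤ → ℚ) *ᵥ ratify v = (m : ℚ) • ratify u := by
    ext i
    have := congrArg (Int.cast : ℤ → ℚ) (congrFun h i)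
    simpa [mulVec, dotProduct, ratify] using this
  have h2 : ratify v = (m : ℚ) • ((G.map (Int.cast : ℤ → ℚ))⁻¹ *ᵥ ratify u) := by
    rw [← mulVec_smul, ← h1, mulVec_mulVec, nonsing_inv_mul _ hdet, one_mulVec]
  have h3 : ((v ⬝ᵥ u : ℤ) : ℚ) = ratify v ⬝ᵥ ratify u := by simp [dotProduct, ratify]
  have hm' : (m : ℚ) ≠ 0 := by exact_mod_cast hm
  rw [discQuad, h3, h2, smul_dotProduct, smul_eq_mul, mul_div_cancel_left₀ _ hm', dotProduct_comm]

theorem addCircle_two_coe_eq_half_iff {a : ℚ} :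
    (a : AddCircle (2 : ℚ)) = ((1 / 2 : ℚ) : AddCircle (2 : ℚ)) ↔ ∃ t : ℤ, a = 1 / 2 + 2 * t := by
  rw [← sub_eq_zero, ← AddCircle.coe_sub, AddCircle.coe_eq_zero_iff]
  refine exists_congr fun t => ?_
  rw [zsmul_eq_mul]
  constructor <;> intro h <;> linarith

theorem nearlyUnimodular_toBilin' {n : ℕ} {G : Matrix (Fin n) (Fin n) ℤ} (hT : Gᵀ = G)
    (hE : ∀ x, Even (x ⬝ᵥ G *ᵥ x)) (hcard : Nat.card (DiscGroup G) = 2) (hG : G.det ≠ 0)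
    {u : Fin n → ℤ} (hu : discQuad G u = ((1 / 2 : ℚ) : AddCircle (2 : ℚ))) :
    ∃ v, NearlyUnimodular (Matrix.toBilin' G) (dotProductBilin ℤ ℤ u) v := by
  have hfun : ∀ x y, Matrix.toBilin' G x y = G *ᵥ x ⬝ᵥ y := fun x y => by
    rw [Matrix.toBilin'_apply', dotProduct_mulVec, ← mulVec_transpose, hT]
  have hu0 : discMk G u ≠ discMk G 0 := by
    rw [Ne, discMk_eq_iff]
    rintro ⟨y, hy⟩
    rw [sub_zero] at hy
    rw [discQuad_eq hG one_ne_zero (v := y) (by rw [hy, one_smul]),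
      addCircle_two_coe_eq_half_iff] at hu
    obtain ⟨t, ht⟩ := hu
    obtain ⟨s, hs⟩ := hE y
    rw [hy] at hs
    rw [hs] at ht
    have : (2 * (s + s) : ℤ) = 1 + 4 * t := by
      qify
      push_cast at ht
      linarith
    omega
  have hcases : ∀ a : Fin n → ℤ, discMk G a = discMk G 0 ∨ discMk G a = discMk G u := by
    intro a
    obtain ⟨y, -, hy⟩ := (Nat.card_eq_two_iff' (discMk G 0)).mp hcard
    refine or_iff_not_imp_left.mpr fun ha => ?_
    rw [hy _ ha, hy _ hu0]
  have h2u : discMk G ((2 : ℤ) • u) = discMk G 0 := by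
    refine (hcases _).resolve_right fun h => hu0 ?_
    rw [discMk_eq_iff] at h ⊢
    obtain ⟨z, hz⟩ := h
    exact ⟨z, by rw [hz, two_smul, add_sub_cancel_right, sub_zero]⟩
  obtain ⟨v, hv⟩ := discMk_eq_iff.mp h2u
  rw [sub_zero] at hv
  have hvv : G *ᵥ v ⬝ᵥ v = 2 * (v ⬝ᵥ u) := by rw [hv, smul_dotProduct, dotProduct_comm, smul_eq_mul]
  rw [discQuad_eq hG two_ne_zero hv, addCircle_two_coe_eq_half_iff] at hu
  obtain ⟨t, ht⟩ := hu
  refine ⟨v, fun x hx => ?_, ?_, ⟨t, ?_⟩, fun g => ?_⟩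
  · refine mulVec_injective_of_det_ne_zero hG ?_
    rw [mulVec_zero]
    refine dotProduct_eq_zero _ fun y => ?_
    rw [← hfun, hx, LinearMap.zero_apply]
  · refine LinearMap.ext fun x => ?_
    rw [hfun, hv, smul_dotProduct]
    rfl
  · rw [hfun, hvv]
    have : (v ⬝ᵥ u : ℤ) = 1 + 4 * t := by
      qify
      push_cast at ht
      linarith
    omega
  · let a : Fin n → ℤ := fun i => g fun j => if i = j then 1 else 0
    have hg : ∀ y, g y = a ⬝ᵥ y := fun y => by
      rw [LinearMap.pi_apply_eq_sum_univ g y, dotProduct_comm]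
      rfl
    obtain h | h := hcases a <;> obtain ⟨z, hz⟩ := discMk_eq_iff.mp h
    · refine ⟨z, Or.inl (LinearMap.ext fun y => ?_)⟩
      rw [hfun, hz, sub_zero, hg]
    · refine ⟨z, Or.inr (LinearMap.ext fun y => ?_)⟩
      rw [LinearMap.add_apply, hfun, hz, hg, sub_dotProduct, dotProductBilin_apply_apply]
      ring

theorem exists_isometry_of_discQuad {r k q : ℕ} {G G' : Matrix (Fin (r + 1)) (Fin (r + 1)) ℤ}
    (hT : Gᵀ = G) (hT' : G'ᵀ = G') (hE : ∀ x, Even (x ⬝ᵥ G *ᵥ x)) (hE' : ∀ x, Even (x ⬝ᵥ G' *ᵥ x))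
    (hG : G.det ≠ 0) (hG' : G'.det ≠ 0) (hcard : Nat.card (DiscGroup G) = 2)
    (hcard' : Nat.card (DiscGroup G') = 2) (hs : HasSignature G (k + 1) q)
    (hs' : HasSignature G' (k + 1) q) {u u' : Fin (r + 1) → ℤ}
    (hu : discQuad G u = ((1 / 2 : ℚ) : AddCircle (2 : ℚ)))
    (hu' : discQuad G' u' = ((1 / 2 : ℚ) : AddCircle (2 : ℚ))) (h3 : 3 ≤ r) (h0 : 0 < k)
    (hkr : k < r) : ∃ e : (Fin (r + 1) → ℤ) ≃ₗ[ℤ] (Fin (r + 1) → ℤ), ∀ x y,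
      x ⬝ᵥ G *ᵥ y = e x ⬝ᵥ G' *ᵥ e y := by
  obtain ⟨v, hv⟩ := nearlyUnimodular_toBilin' hT hE hcard hG hu
  obtain ⟨v', hv'⟩ := nearlyUnimodular_toBilin' hT' hE' hcard' hG' hu'
  have hsymm : ∀ {A : Matrix (Fin (r + 1)) (Fin (r + 1)) ℤ}, Aᵀ = A →
      ∀ x y, Matrix.toBilin' A x y = Matrix.toBilin' A y x := fun {A} hA x y => by
    rw [Matrix.toBilin'_apply', Matrix.toBilin'_apply', dotProduct_mulVec, ← mulVec_transpose, hA,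
      dotProduct_comm]
  obtain ⟨τ, hτ⟩ := hv.exists_isometry hv' (hsymm hT) (hsymm hT')
    (fun x => by rw [Matrix.toBilin'_apply']; exact hE x)
    (fun x => by rw [Matrix.toBilin'_apply']; exact hE' x) (Module.finrank_fin_fun ℤ)
    (Module.finrank_fin_fun ℤ) hs.hasPosIndex hs'.hasPosIndex h3 h0 hkr
  refine ⟨τ, fun x y => ?_⟩
  rw [← Matrix.toBilin'_apply', ← Matrix.toBilin'_apply', hτ]

end DiscriminantForm

/-- `M = ⟨2⟩ ⊥ U⁵ ⊥ (E₈(−1))⁴` is an even lattice of rank 43 and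
signature `(6, 37)` whose discriminant group is cyclic of order 2, and every even
lattice `L` of signature `(6, 37)` admitting a group isomorphism `A(L) → A(M)`
preserving the discriminant quadratic forms is isometric to `M`. -/
theorem big_even_lattice_unique_in_genus :
    (∀ x : Fin 43 → ℤ, Even (x ⬝ᵥ M43.mulVec x)) ∧
    HasSignature M43 6 37 ∧
    (IsAddCyclic (DiscGroup M43) ∧ Nat.card (DiscGroup M43) = 2) ∧
    (∀ L : Matrix (Fin 43) (Fin 43) ℤ,
      L.transpose = L →
      L.det ≠ 0 →
      (∀ x : Fin 43 → ℤ, Even (x ⬝ᵥ L.mulVec x)) →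
      HasSignature L 6 37 →
      (∃ φ : DiscGroup L ≃+ DiscGroup M43,
        ∀ (u : Fin 43 → ℤ) (u' : Fin 43 → ℤ),
          φ (discMk L u) = discMk M43 u' → discQuad M43 u' = discQuad L u) →
      ∃ e : (Fin 43 → ℤ) ≃ₗ[ℤ] (Fin 43 → ℤ), ∀ x y : Fin 43 → ℤ,
        x ⬝ᵥ L.mulVec y = (e x) ⬝ᵥ M43.mulVec (e y)) := by
  have hdet : M43.det ≠ 0 := fun h => by simpa [h] using evenGram_M43.det
  have hcard : Nat.card (DiscGroup M43) = 2 := (nat_card_discGroup hdet).trans evenGram_M43.det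
  refine ⟨evenGram_M43.even, evenGram_M43.signature, ⟨?_, hcard⟩, ?_⟩
  · have : Fact (Nat.Prime 2) := ⟨Nat.prime_two⟩
    exact isAddCyclic_of_prime_card hcard
  · rintro L hT hdet' hE hs ⟨φ, hφ⟩
    obtain ⟨v, u', hv, hu'⟩ := exists_M43_mulVec
    have hq : discQuad M43 u' = ((1 / 2 : ℚ) : AddCircle (2 : ℚ)) := by
      rw [discQuad_eq hdet two_ne_zero hv, hu']
      norm_num
    obtain ⟨u, hu⟩ := Submodule.Quotient.mk_surjective _ (φ.symm (discMk M43 u'))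
    have hqu : discQuad M43 u' = discQuad L u :=
      hφ u u' (by rw [← φ.apply_symm_apply (discMk M43 u'), ← hu]; rfl)
    exact exists_isometry_of_discQuad hT evenGram_M43.transpose hE evenGram_M43.even hdet' hdet
      ((Nat.card_congr φ.toEquiv).trans hcard) hcard hs evenGram_M43.signature
      (hqu.symm.trans hq) hq (by norm_num) (by norm_num) (by norm_num)
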